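/- Let 𝔽_q be a finite field of characteristic p and let φ ∈ 𝔽_q(x) have degree d with 2 ≤ d < p. For each n ≥ 1, let F_n(x) be the numerator of φ^n(x) − t, let K_n^arith (resp. K_n^geom) be its splitting field over 𝔽_q(t) (resp. over 𝔽̄_q(t)), let m_n = [(K_n^arith ∩ 𝔽̄_q) : 𝔽_q], let G_n = Gal(K_n^geom / 𝔽̄_q(t)) acting on the d^n roots of F_n, and set FPP(pgIMG(φ)/𝔽_q) = lim_{n→∞} FPP(G_n) (this non-increasing limit exists). Then for every ε > 0 there are positive integers M and k₀ such that #Per(φ, ℙ¹(𝔽_{q^{Mk}}))/(q^{Mk} + 1) < FPP(pgIMG(φ)/𝔽_q) + ε for all k > k₀; moreover one can take M ≤ limsup_{n→∞} m_n. -/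

import Mathlib

open Polynomial

/-- Composition of the pair `(p, q)` (representing `p/q`) with the pair `(r, s)`:
homogenization of the substitution `x ↦ r/s`, giving a pair representing
`(p/q) ∘ (r/s)`. -/
noncomputable def pairComp {K : Type*} [CommRing K] (p q r s : Polynomial K) :
    Polynomial K × Polynomial K :=
  (∑ i ∈ Finset.range (max p.natDegree q.natDegree + 1),
      C (p.coeff i) * r ^ i * s ^ (max p.natDegree q.natDegree - i),
   ∑ i ∈ Finset.range (max p.natDegree q.natDegree + 1),
      C (q.coeff i) * r ^ i * s ^ (max p.natDegree q.natDegree - i))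

/-- The pair `(p_n, q_n)` representing the `n`-th iterate `φ^n = p_n/q_n` of the
rational function `φ = p/q` (with `φ^0 = x`). -/
noncomputable def iterPair {K : Type*} [CommRing K] (p q : Polynomial K) :
    ℕ → Polynomial K × Polynomial K
  | 0 => (X, 1)
  | n + 1 => pairComp p q (iterPair p q n).1 (iterPair p q n).2

/-- The numerator of `φ^n(x) - t` as a polynomial in `x` over the function field
`F(t) = RatFunc F`: namely `p_n(x) - t · q_n(x)` where `φ^n = p_n/q_n`. -/
noncomputable def PhiPoly (F : Type*) [Field F] (p q : Polynomial F) (n : ℕ) :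
    Polynomial (RatFunc F) :=
  ((iterPair p q n).1).map (RatFunc.C : F →+* RatFunc F)
    - Polynomial.C RatFunc.X * ((iterPair p q n).2).map (RatFunc.C : F →+* RatFunc F)

/-- `x` is algebraic over `A` (with respect to the ring map `σ : A →+* B`). -/
def algebraicOver {A B : Type*} [CommRing A] [CommRing B] (σ : A →+* B) (x : B) : Prop :=
  ∃ P : Polynomial A, P ≠ 0 ∧ Polynomial.eval₂ σ x P = 0



open Classical in
/-- The self-map of `ℙ¹(Ω) = Ω ∪ {∞}` (modeled as `Option Ω`, with `none = ∞`)
induced by the rational function `p/q`, where `p q : Polynomial Ω` are assumed coprime. -/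
noncomputable def ratMapP1 {Ω : Type*} [Field Ω] (p q : Polynomial Ω) : Option Ω → Option Ω :=
  fun z => match z with
  | some a => if q.eval a = 0 then none else some (p.eval a / q.eval a)
  | none =>
      if q.natDegree < p.natDegree then none
      else if p.natDegree < q.natDegree then some 0
      else some (p.leadingCoeff / q.leadingCoeff)

open Classical in
/-- The Möbius transformation `z ↦ (a z + b)/(c z + d)` of `ℙ¹(Ω)`, for an
invertible matrix `(a b; c d)`. -/
noncomputable def mobiusMap {Ω : Type*} [Field Ω] (a b c d : Ω) : Option Ω → Option Ω :=
  fun z => match z with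
  | some x => if c * x + d = 0 then none else some ((a * x + b) / (c * x + d))
  | none => if c = 0 then none else some (a / c)

open Classical in
/-- The ramification index of the rational function `p/q` at a finite point `x`. -/
noncomputable def ramAt {Ω : Type*} [Field Ω] (p q : Polynomial Ω) (x : Ω) : ℕ :=
  if q.eval x = 0 then Polynomial.rootMultiplicity x q
  else Polynomial.rootMultiplicity x (p - C (p.eval x / q.eval x) * q)

/-- The ramification index `e_{p/q}(α)` of the rational function `p/q` at a point
`α ∈ ℙ¹(Ω)`; the index at `∞` is computed from the reversed polynomials. -/
noncomputable def ramIdxP1 {Ω : Type*} [Field Ω] (p q : Polynomial Ω) : Option Ω → ℕ :=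
  fun z => match z with
  | some x => ramAt p q x
  | none =>
      ramAt (p.reverse * X ^ (max p.natDegree q.natDegree - p.natDegree))
            (q.reverse * X ^ (max p.natDegree q.natDegree - q.natDegree)) 0

/-- The set of critical points in `ℙ¹(Ω)` of the rational function `p/q`. -/
def critSetP1 {Ω : Type*} [Field Ω] (p q : Polynomial Ω) : Set (Option Ω) :=
  {α | 1 < ramIdxP1 p q α}

/-- The post-critical set `P_φ = ⋃_{k ≥ 1} φ^k(C_φ)` of `φ = p/q`. -/
def postCritP1 {Ω : Type*} [Field Ω] (p q : Polynomial Ω) : Set (Option Ω) :=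
  ⋃ k : ℕ, (ratMapP1 p q)^[k + 1] '' critSetP1 p q

/-- `φ = p/q` is a Lattès map: there is `r : ℙ¹(Ω) → ℤ` with
`r(φ(α)) = e_φ(α) · r(α)` for all `α` and `r(α) = 1` outside the post-critical set. -/
def IsLattesPair {Ω : Type*} [Field Ω] (p q : Polynomial Ω) : Prop :=
  ∃ r : Option Ω → ℤ,
    (∀ α : Option Ω, r (ratMapP1 p q α) = ramIdxP1 p q α * r α) ∧
    ∀ α : Option Ω, α ∉ postCritP1 p q → r α = 1

/-- The rational maps `p/q` and `r/s` are Möbius-conjugate over `Ω`: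
`(r/s) ∘ μ = μ ∘ (p/q)` on `ℙ¹(Ω)` for some Möbius transformation `μ`. -/
def MobiusConjugate {Ω : Type*} [Field Ω] (p q r s : Polynomial Ω) : Prop :=
  ∃ a b c d : Ω, a * d - b * c ≠ 0 ∧
    ∀ z : Option Ω, ratMapP1 r s (mobiusMap a b c d z) = mobiusMap a b c d (ratMapP1 p q z)

/-- `φ = p/q` is dynamically exceptional: there is a finite nonempty
`Γ ⊆ ℙ¹(Ω)` with `φ⁻¹(Γ) \ C_φ = Γ`. -/
def DynExceptional {Ω : Type*} [Field Ω] (p q : Polynomial Ω) : Prop :=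
  ∃ Γ : Set (Option Ω), Γ.Finite ∧ Γ.Nonempty ∧
    (ratMapP1 p q) ⁻¹' Γ \ critSetP1 p q = Γ

/-- The number of points of `ℙ¹(𝔽_{q^N})` (realized inside `ℙ¹` of the algebraic
closure of `F`, where `q = #F`) that are periodic under the rational map `p/q`. -/
noncomputable def perCount (F : Type*) [Field F] [Fintype F] (p q : Polynomial F)
    (N : ℕ) : ℕ :=
  Set.ncard {α : Option (AlgebraicClosure F) |
    (α = none ∨ ∃ a : AlgebraicClosure F, α = some a ∧ a ^ Fintype.card F ^ N = a) ∧
    ∃ m : ℕ, 1 ≤ m ∧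
      (ratMapP1 (p.map (algebraMap F (AlgebraicClosure F)))
        (q.map (algebraMap F (AlgebraicClosure F))))^[m] α = α}

open Polynomial

/-- The fixed point proportion of the geometric Galois group
`G_n = Gal(K_n^geom / 𝔽̄_q(t))` acting on the roots of the numerator of
`φ^n(x) - t` over `𝔽̄_q(t)`. -/
noncomputable def FPPgeo (F : Type*) [Field F] (p q : Polynomial F) (n : ℕ) : ℝ :=
  (Nat.card {g : (PhiPoly (AlgebraicClosure F) (p.map (algebraMap F (AlgebraicClosure F)))
        (q.map (algebraMap F (AlgebraicClosure F))) n).Gal //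
      ∃ r ∈ (PhiPoly (AlgebraicClosure F) (p.map (algebraMap F (AlgebraicClosure F)))
          (q.map (algebraMap F (AlgebraicClosure F))) n).rootSet
          (PhiPoly (AlgebraicClosure F) (p.map (algebraMap F (AlgebraicClosure F)))
            (q.map (algebraMap F (AlgebraicClosure F))) n).SplittingField, g r = r} : ℝ)
    / (Nat.card (PhiPoly (AlgebraicClosure F) (p.map (algebraMap F (AlgebraicClosure F)))
        (q.map (algebraMap F (AlgebraicClosure F))) n).Gal : ℝ)

namespace StepanovBound

/-- `b` is integral over the ring `κ[τ]`. -/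
def IntegralOver (κ : Type*) {E : Type*} [Field κ] [Field E] [Algebra κ E] (τ b : E) : Prop :=
  (aeval τ : κ[X] →ₐ[κ] E).toRingHom.IsIntegralElem b

section Basic

variable {κ E : Type*} [Field κ] [Field E] [Algebra κ E] {τ b c : E}

lemma IntegralOver.add (hb : IntegralOver κ τ b) (hc : IntegralOver κ τ c) :
    IntegralOver κ τ (b + c) := RingHom.IsIntegralElem.add _ hb hc

lemma IntegralOver.mul (hb : IntegralOver κ τ b) (hc : IntegralOver κ τ c) :
    IntegralOver κ τ (b * c) := RingHom.IsIntegralElem.mul _ hb hc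

lemma integralOver_aeval (P : κ[X]) : IntegralOver κ τ (aeval τ P) :=
  RingHom.isIntegralElem_map (aeval τ : κ[X] →ₐ[κ] E).toRingHom

lemma integralOver_algebraMap (x : κ) : IntegralOver κ τ (algebraMap κ E x) := by
  simpa using integralOver_aeval (τ := τ) (C x)

lemma integralOver_self : IntegralOver κ τ τ := by
  simpa using integralOver_aeval (τ := τ) (X : κ[X])

lemma integralOver_one : IntegralOver κ τ (1 : E) := by
  simpa using integralOver_algebraMap (τ := τ) (1 : κ)

lemma integralOver_zero : IntegralOver κ τ (0 : E) := by
  simpa using integralOver_algebraMap (τ := τ) (0 : κ)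

lemma IntegralOver.pow (hb : IntegralOver κ τ b) (n : ℕ) : IntegralOver κ τ (b ^ n) := by
  induction n with
  | zero => simpa using integralOver_one
  | succ n ih => rw [pow_succ]; exact ih.mul hb

lemma IntegralOver.prod {ι : Type*} (s : Finset ι) (f : ι → E)
    (h : ∀ i ∈ s, IntegralOver κ τ (f i)) : IntegralOver κ τ (∏ i ∈ s, f i) := by
  classical
  induction s using Finset.induction_on with
  | empty => simpa using integralOver_one
  | insert a s ha ih =>
    rw [Finset.prod_insert ha]
    exact (h a (by simp)).mul (ih fun i hi => h i (by simp [hi]))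

/-- Integrality is preserved by ring homomorphisms which are semilinear and fix `τ`. -/
lemma IntegralOver.map_semilinear {E' : Type*} [Field E'] [Algebra κ E'] {τ' : E'}
    (hb : IntegralOver κ τ b) (ρ : E →+* E') (f : κ →+* κ)
    (hρ : ∀ x, ρ (algebraMap κ E x) = algebraMap κ E' (f x)) (hτ : ρ τ = τ') :
    IntegralOver κ τ' (ρ b) := by
  obtain ⟨P, hP, hPb⟩ := hb
  refine ⟨P.map (mapRingHom f), hP.map _, ?_⟩
  have h := congrArg ρ hPb
  rw [hom_eval₂, map_zero] at h
  rw [eval₂_map, ← h]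
  congr 1
  ext x <;> simp [hρ, hτ]

end Basic

/-- The functions with poles only at infinity, of order at most `ℓ` at each place. -/
def boundedPoles (κ : Type*) {E : Type*} [Field κ] [Field E] [Algebra κ E] (t : E) (ℓ : ℕ) :
    Submodule κ E where
  carrier := {b | IntegralOver κ t b ∧ IntegralOver κ t⁻¹ (t⁻¹ ^ ℓ * b)}
  zero_mem' := ⟨integralOver_zero, by simpa using integralOver_zero⟩
  add_mem' := fun ha hb => ⟨ha.1.add hb.1, by rw [mul_add]; exact ha.2.add hb.2⟩
  smul_mem' := fun x b hb => by
    refine ⟨?_, ?_⟩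
    · rw [Algebra.smul_def]; exact (integralOver_algebraMap x).mul hb.1
    · rw [Algebra.smul_def, mul_left_comm]; exact (integralOver_algebraMap x).mul hb.2

section BoundedPoles

variable {κ E : Type*} [Field κ] [Field E] [Algebra κ E] {t b c : E} {ℓ m : ℕ}

lemma mem_boundedPoles : b ∈ boundedPoles κ t ℓ ↔
    IntegralOver κ t b ∧ IntegralOver κ t⁻¹ (t⁻¹ ^ ℓ * b) := Iff.rfl

lemma mul_mem_boundedPoles (hb : b ∈ boundedPoles κ t ℓ) (hc : c ∈ boundedPoles κ t m) :
    b * c ∈ boundedPoles κ t (ℓ + m) := by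
  refine ⟨hb.1.mul hc.1, ?_⟩
  rw [pow_add, mul_mul_mul_comm]
  exact hb.2.mul hc.2

lemma pow_mem_boundedPoles (hb : b ∈ boundedPoles κ t ℓ) (n : ℕ) :
    b ^ n ∈ boundedPoles κ t (ℓ * n) := by
  refine ⟨hb.1.pow n, ?_⟩
  rw [pow_mul, ← mul_pow]
  exact hb.2.pow n

lemma map_mem_boundedPoles (hb : b ∈ boundedPoles κ t ℓ) (ρ : E →+* E) (f : κ →+* κ)
    (hρ : ∀ x, ρ (algebraMap κ E x) = algebraMap κ E (f x)) (ht : ρ t = t) :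
    ρ b ∈ boundedPoles κ t ℓ := by
  refine ⟨hb.1.map_semilinear ρ f hρ ht, ?_⟩
  have := hb.2.map_semilinear ρ f hρ (τ' := t⁻¹) (by rw [map_inv₀, ht])
  simpa [ht] using this

lemma boundedPoles_mono (h : ℓ ≤ m) : boundedPoles κ t ℓ ≤ boundedPoles κ t m := by
  intro b hb
  refine ⟨hb.1, ?_⟩
  obtain ⟨k, rfl⟩ := Nat.exists_eq_add_of_le h
  rw [add_comm, pow_add, mul_assoc]
  exact (integralOver_self.pow k).mul hb.2

lemma pow_self_mem_boundedPoles (ht : t ≠ 0) {i : ℕ} (hi : i ≤ ℓ) :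
    t ^ i ∈ boundedPoles κ t ℓ := by
  refine boundedPoles_mono hi ⟨integralOver_self.pow i, ?_⟩
  rw [← mul_pow, inv_mul_cancel₀ ht, one_pow]
  exact integralOver_one

/-- An element integral over `κ[t]` has poles of bounded order at infinity. -/
lemma IntegralOver.exists_mem_boundedPoles (ht : t ≠ 0) (hb : IntegralOver κ t b) :
    ∃ ℓ, b ∈ boundedPoles κ t ℓ := by
  obtain ⟨P, hP, hPb⟩ := id hb
  -- a bound for the degrees of the coefficients
  obtain ⟨N, hN⟩ : ∃ N, ∀ i, (P.coeff i).natDegree ≤ N := by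
    refine ⟨P.support.sup fun i => (P.coeff i).natDegree, fun i => ?_⟩
    by_cases hi : i ∈ P.support
    · exact Finset.le_sup (f := fun i => (P.coeff i).natDegree) hi
    · rw [notMem_support_iff] at hi; simp [hi]
  refine ⟨N, hb, ?_⟩
  -- the polynomial whose coefficients are rewritten in terms of `t⁻¹`
  have key : ∀ (Q : κ[X]) (M : ℕ), Q.natDegree ≤ M →
      aeval t⁻¹ (Q.reflect M) = t⁻¹ ^ M * aeval t Q := by
    intro Q M hM
    let := invertibleOfNonzero ht
    have h := eval₂_reflect_mul_pow (algebraMap κ E) t M Q hM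
    rw [invOf_eq_inv] at h
    rw [aeval_def, aeval_def, ← h, mul_comm, mul_assoc, ← mul_pow, mul_inv_cancel₀ ht, one_pow,
      mul_one]
  set n := P.natDegree with hn
  have hsum : b ^ n + ∑ i ∈ Finset.range n, aeval t (P.coeff i) * b ^ i = 0 := by
    rw [eval₂_eq_sum_range, Finset.sum_range_succ, hP.coeff_natDegree, ← hn] at hPb
    rw [← hPb, add_comm]
    simp
  refine ⟨X ^ n + ∑ i ∈ Finset.range n, C ((P.coeff i).reflect (N * (n - i))) * X ^ i, ?_, ?_⟩
  · refine monic_X_pow_add ?_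
    refine (degree_sum_le _ _).trans_lt ?_
    refine (Finset.sup_lt_iff (WithBot.bot_lt_coe n)).2 fun i hi => ?_
    exact (degree_C_mul_X_pow_le _ _).trans_lt (Nat.cast_lt.2 (Finset.mem_range.1 hi))
  · rw [eval₂_add, eval₂_finsetSum]
    simp only [eval₂_mul, eval₂_C, eval₂_X_pow]
    have hmul := congrArg (t⁻¹ ^ (N * n) * ·) hsum
    simp only [mul_zero, mul_add, Finset.mul_sum] at hmul
    rw [← hmul, mul_pow, ← pow_mul]
    congr 1
    refine Finset.sum_congr rfl fun i hi => ?_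
    have hi' := Finset.mem_range.1 hi
    change aeval t⁻¹ _ * _ = _
    rw [key _ _ ((hN i).trans (Nat.le_mul_of_pos_right _ (by omega))), mul_pow, ← pow_mul]
    have : N * n = N * (n - i) + N * i := by rw [← mul_add]; congr 1; omega
    rw [this, pow_add]
    ring

end BoundedPoles


section Norm

variable {κ : Type*} [Field κ]

lemma IntegralOver.of_algebraMap {K E : Type*} [Field K] [Field E] [Algebra κ K] [Algebra κ E]
    [Algebra K E] [IsScalarTower κ K E] {τ y : K}
    (h : IntegralOver κ (algebraMap K E τ) (algebraMap K E y)) : IntegralOver κ τ y := by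
  obtain ⟨P, hP, hPy⟩ := h
  refine ⟨P, hP, (algebraMap K E).injective ?_⟩
  rw [map_zero, hom_eval₂, ← hPy]
  congr 1
  ext x
  · simpa using (IsScalarTower.algebraMap_apply κ K E x).symm
  · simp

lemma exists_polynomial_of_integralOver_X {y : RatFunc κ} (h : IntegralOver κ RatFunc.X y) :
    ∃ w : κ[X], algebraMap κ[X] (RatFunc κ) w = y := by
  have hy : IsIntegral κ[X] y := by
    obtain ⟨P, hP, hPy⟩ := h
    refine ⟨P, hP, ?_⟩
    rw [← hPy]
    congr 1
    ext x <;> simp [RatFunc.algebraMap_eq_C]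
  exact IsIntegrallyClosed.algebraMap_eq_of_integral hy

lemma natDegree_le_of_integralOver_X_inv {w : κ[X]} {M : ℕ}
    (h : IntegralOver κ (RatFunc.X : RatFunc κ)⁻¹
      (RatFunc.X⁻¹ ^ M * algebraMap κ[X] (RatFunc κ) w)) : w.natDegree ≤ M := by
  classical
  by_cases hw : w = 0
  · simp [hw]
  set v := RatFunc.inftyValuation κ with hv
  have hX : v RatFunc.X⁻¹ ≤ 1 := by
    rw [map_inv₀, RatFunc.inftyValuation.X, ← WithZero.exp_neg, ← WithZero.exp_zero]
    exact WithZero.exp_le_exp.2 (by norm_num)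
  have hrange : ∀ P : κ[X], aeval (RatFunc.X⁻¹ : RatFunc κ) P ∈ v.integer := by
    intro P
    induction P using Polynomial.induction_on' with
    | add p q hp hq => rw [map_add]; exact v.integer.add_mem hp hq
    | monomial n a =>
      rw [aeval_monomial]
      refine v.integer.mul_mem ?_ (v.integer.pow_mem hX n)
      rw [RatFunc.algebraMap_eq_C]
      by_cases ha : a = 0
      · rw [ha, map_zero]; exact v.integer.zero_mem
      · exact (RatFunc.inftyValuation.C κ ha).le
  obtain ⟨P, hP, hPy⟩ := h
  have h_int : IsIntegral v.integer (RatFunc.X⁻¹ ^ M * algebraMap κ[X] (RatFunc κ) w) := by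
    refine ⟨P.map (RingHom.codRestrict
      (aeval (RatFunc.X⁻¹ : RatFunc κ) : κ[X] →ₐ[κ] RatFunc κ).toRingHom v.integer hrange),
      hP.map _, ?_⟩
    rw [eval₂_map, ← hPy]
    rfl
  have hle := (Valuation.integer.integers v).mem_of_integral h_int
  rw [Valuation.mem_integer_iff, map_mul, map_pow, map_inv₀, RatFunc.inftyValuation.X,
    hv, RatFunc.inftyValuation_apply, RatFunc.inftyValuation.polynomial κ hw, ← WithZero.exp_neg,
    ← WithZero.exp_nsmul, ← WithZero.exp_add, ← WithZero.exp_zero, WithZero.exp_le_exp] at hle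
  simp at hle
  omega

variable {E : Type*} [Field E] [Algebra (RatFunc κ) E]

/-- The variable `t` of the rational function field, inside an extension `E`. -/
noncomputable def tvar (κ E : Type*) [Field κ] [Field E] [Algebra (RatFunc κ) E] : E :=
  algebraMap (RatFunc κ) E RatFunc.X

lemma tvar_ne_zero : tvar κ E ≠ 0 := by
  simp [tvar, RatFunc.X_ne_zero]

lemma galois_tvar (g : Gal(E/RatFunc κ)) : g (tvar κ E) = tvar κ E := AlgEquiv.commutes _ _

variable [Algebra κ E] [IsScalarTower κ (RatFunc κ) E]

lemma aeval_tvar (w : κ[X]) :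
    aeval (tvar κ E) w = algebraMap (RatFunc κ) E (algebraMap κ[X] (RatFunc κ) w) := by
  rw [tvar, aeval_algebraMap_apply]
  congr 1
  rw [← RatFunc.algebraMap_X, aeval_algebraMap_apply, aeval_X_left_apply]

lemma galois_algebraMap (g : Gal(E/RatFunc κ)) (x : κ) :
    g (algebraMap κ E x) = algebraMap κ E x := by
  rw [IsScalarTower.algebraMap_apply κ (RatFunc κ) E, AlgEquiv.commutes]

lemma galois_integralOver (g : Gal(E/RatFunc κ)) {b : E}
    (hb : IntegralOver κ (tvar κ E) b) : IntegralOver κ (tvar κ E) (g b) :=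
  hb.map_semilinear (g : E →+* E) (RingHom.id κ) (galois_algebraMap g) (galois_tvar g)

lemma galois_mem_boundedPoles (g : Gal(E/RatFunc κ)) {b : E} {ℓ : ℕ}
    (hb : b ∈ boundedPoles κ (tvar κ E) ℓ) : g b ∈ boundedPoles κ (tvar κ E) ℓ :=
  map_mem_boundedPoles hb (g : E →+* E) (RingHom.id κ) (galois_algebraMap g) (galois_tvar g)

variable [FiniteDimensional (RatFunc κ) E] [IsGalois (RatFunc κ) E]

/-- The norm of a function with bounded poles is a polynomial of bounded degree. -/
lemma exists_norm_polynomial {b : E} {ℓ : ℕ} (hb : b ∈ boundedPoles κ (tvar κ E) ℓ) :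
    ∃ w : κ[X], aeval (tvar κ E) w = ∏ g : Gal(E/RatFunc κ), g b ∧
      w.natDegree ≤ ℓ * Nat.card Gal(E/RatFunc κ) := by
  have hnorm := Algebra.norm_eq_prod_automorphisms (RatFunc κ) b
  have h1 : IntegralOver κ (tvar κ E) (∏ g : Gal(E/RatFunc κ), g b) :=
    IntegralOver.prod _ _ fun g _ => galois_integralOver g hb.1
  have h2 : IntegralOver κ (tvar κ E)⁻¹
      ((tvar κ E)⁻¹ ^ (ℓ * Nat.card Gal(E/RatFunc κ)) * ∏ g : Gal(E/RatFunc κ), g b) := by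
    have := IntegralOver.prod (κ := κ) (τ := (tvar κ E)⁻¹) Finset.univ
      (fun g : Gal(E/RatFunc κ) => (tvar κ E)⁻¹ ^ ℓ * g b)
      fun g _ => (galois_mem_boundedPoles g hb).2
    rwa [Finset.prod_mul_distrib, Finset.prod_const, ← pow_mul, Finset.card_univ,
      ← Nat.card_eq_fintype_card] at this
  rw [← hnorm] at h1 h2
  obtain ⟨w, hw⟩ := exists_polynomial_of_integralOver_X (h1.of_algebraMap (τ := RatFunc.X))
  refine ⟨w, by rw [aeval_tvar, hw, hnorm], ?_⟩
  rw [← hw] at h2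
  apply natDegree_le_of_integralOver_X_inv
  apply IntegralOver.of_algebraMap (E := E)
  simpa [tvar] using h2

end Norm


lemma prod_galois_ne_zero {K E : Type*} [Field K] [Field E] [Algebra K E] [FiniteDimensional K E]
    {b : E} (hb : b ≠ 0) : ∏ g : Gal(E/K), g b ≠ 0 :=
  Finset.prod_ne_zero_iff.2 fun g _ => by simpa using hb

section Expansion

variable {κ : Type*} [Field κ] {E : Type*} [Field E] [Algebra (RatFunc κ) E] [Algebra κ E]

/-- A ring homomorphism `E → κ((T))` over `κ` which sends `t` to `t₀ + T`. -/
structure IsExpansion (t₀ : κ) (ι : E →+* LaurentSeries κ) : Prop where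
  map_const : ∀ x : κ, ι (algebraMap κ E x) =
    algebraMap (PowerSeries κ) (LaurentSeries κ) (PowerSeries.C x)
  map_tvar : ι (tvar κ E) =
    algebraMap (PowerSeries κ) (LaurentSeries κ) (PowerSeries.C t₀ + PowerSeries.X)

variable {t₀ : κ} {ι : E →+* LaurentSeries κ}

lemma IsExpansion.map_aeval (h : IsExpansion t₀ ι) (w : κ[X]) :
    ι (aeval (tvar κ E) w) =
      algebraMap (PowerSeries κ) (LaurentSeries κ) (taylor t₀ w : κ[X]) := by
  have : ι.comp (aeval (tvar κ E) : κ[X] →ₐ[κ] E).toRingHom =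
      (algebraMap (PowerSeries κ) (LaurentSeries κ)).comp
        ((coeToPowerSeries.ringHom (R := κ)).comp (taylorAlgHom t₀).toRingHom) := by
    ext x
    · simp [h.map_const]
    · simp [h.map_tvar, add_comm]
  exact congrArg (fun f => f w) this

lemma IsExpansion.exists_powerSeries (h : IsExpansion t₀ ι) {b : E}
    (hb : IntegralOver κ (tvar κ E) b) :
    ∃ s : PowerSeries κ, ι b = algebraMap (PowerSeries κ) (LaurentSeries κ) s := by
  have : IsIntegral (PowerSeries κ) (ι b) := by
    obtain ⟨P, hP, hPb⟩ := hb
    refine ⟨P.map ((coeToPowerSeries.ringHom (R := κ)).comp (taylorAlgHom t₀).toRingHom),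
      hP.map _, ?_⟩
    have h0 := congrArg ι hPb
    rw [hom_eval₂, map_zero] at h0
    rw [eval₂_map, ← h0]
    congr 1
    exact RingHom.ext fun w => (h.map_aeval w).symm
  obtain ⟨s, hs⟩ := IsIntegrallyClosed.algebraMap_eq_of_integral this
  exact ⟨s, hs.symm⟩

lemma coeff_zero_algebraMap (s : PowerSeries κ) :
    (algebraMap (PowerSeries κ) (LaurentSeries κ) s).coeff 0 = PowerSeries.constantCoeff s := by
  rw [LaurentSeries.coe_algebraMap]
  exact (LaurentSeries.coeff_coe_powerSeries s 0).trans (by simp)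

lemma X_sub_C_pow_dvd {w : κ[X]} {j : ℕ}
    (h : (PowerSeries.X : PowerSeries κ) ^ j ∣ ((taylor t₀ w : κ[X]) : PowerSeries κ)) :
    (X - C t₀) ^ j ∣ w := by
  have h1 : (X : κ[X]) ^ j ∣ taylor t₀ w := by
    rw [X_pow_dvd_iff]
    intro d hd
    have := PowerSeries.X_pow_dvd_iff.1 h d hd
    rwa [coeff_coe] at this
  obtain ⟨v, hv⟩ := h1
  refine ⟨taylor (-t₀) v, ?_⟩
  have := congrArg (taylor (-t₀)) hv
  rw [taylor_taylor, neg_add_cancel, taylor_zero, taylor_mul, taylor_pow, taylor_X] at this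
  rw [this, map_neg, sub_eq_add_neg]

variable [IsScalarTower κ (RatFunc κ) E] [FiniteDimensional (RatFunc κ) E]
  [IsGalois (RatFunc κ) E]

/-- A function with poles of order at most `ℓ` has at most `ℓ · [E : κ(t)]` zeros. -/
lemma card_zeros_le (ι : κ → E →+* LaurentSeries κ) {b : E} {ℓ : ℕ}
    (hb : b ∈ boundedPoles κ (tvar κ E) ℓ) (hb0 : b ≠ 0) (S : Finset (κ × Gal(E/RatFunc κ)))
    (hS : ∀ x ∈ S, IsExpansion x.1 (ι x.1) ∧ (ι x.1 (x.2 b)).coeff 0 = 0) :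
    S.card ≤ ℓ * Nat.card Gal(E/RatFunc κ) := by
  classical
  obtain ⟨w, hw, hdeg⟩ := exists_norm_polynomial hb
  have hw0 : w ≠ 0 := by
    rintro rfl
    exact prod_galois_ne_zero hb0 (by rw [← hw, map_zero])
  refine le_trans ?_ hdeg
  have hfib : ∀ t₀ ∈ S.image Prod.fst, (S.filter fun x => x.1 = t₀).card ≤ w.roots.count t₀ := by
    intro t₀ ht₀
    obtain ⟨x, hx, rfl⟩ := Finset.mem_image.1 ht₀
    set t₀ := x.1
    have hexp := (hS x hx).1
    rw [count_roots, le_rootMultiplicity_iff hw0]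
    apply X_sub_C_pow_dvd
    choose s hs using fun g : Gal(E/RatFunc κ) =>
      hexp.exists_powerSeries (galois_integralOver g hb.1)
    have hprod : ((taylor t₀ w : κ[X]) : PowerSeries κ) = ∏ g, s g := by
      apply IsFractionRing.injective (PowerSeries κ) (LaurentSeries κ)
      rw [← hexp.map_aeval, hw, map_prod, map_prod]
      exact Finset.prod_congr rfl fun g _ => hs g
    rw [hprod]
    have himg : (S.filter fun x => x.1 = t₀).card =
        ((S.filter fun x => x.1 = t₀).image Prod.snd).card := by
      rw [Finset.card_image_of_injOn]
      intro y hy z hz hyz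
      rw [Finset.coe_filter] at hy hz
      exact Prod.ext (hy.2.trans hz.2.symm) hyz
    rw [himg, ← Finset.prod_const]
    refine (Finset.prod_dvd_prod_of_dvd _ s fun g hg => ?_).trans
      (Finset.prod_dvd_prod_of_subset _ _ s (Finset.subset_univ _))
    obtain ⟨y, hy, rfl⟩ := Finset.mem_image.1 hg
    obtain ⟨hyS, hyt⟩ := Finset.mem_filter.1 hy
    rw [PowerSeries.X_dvd_iff, ← coeff_zero_algebraMap, ← hs]
    have hzero := (hS y hyS).2
    rwa [hyt] at hzero
  calc S.card = ∑ t₀ ∈ S.image Prod.fst, (S.filter fun x => x.1 = t₀).card :=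
        Finset.card_eq_sum_card_image _ _
    _ ≤ ∑ t₀ ∈ S.image Prod.fst, w.roots.count t₀ := Finset.sum_le_sum hfib
    _ ≤ w.roots.card := by
        rw [← Multiset.toFinset_sum_count_eq w.roots]
        refine Finset.sum_le_sum_of_ne_zero fun x _ hx => ?_
        rw [Multiset.mem_toFinset]
        exact Multiset.count_ne_zero.1 hx
    _ ≤ w.natDegree := card_roots' w

/-- The order of vanishing of a function is bounded in terms of its poles. -/
lemma not_X_pow_dvd (hexp : IsExpansion t₀ ι) {b : E} {ℓ : ℕ}
    (hb : b ∈ boundedPoles κ (tvar κ E) ℓ) (hb0 : b ≠ 0) {s : PowerSeries κ}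
    (hs : ι b = algebraMap (PowerSeries κ) (LaurentSeries κ) s) {j : ℕ}
    (hj : ℓ * Nat.card Gal(E/RatFunc κ) < j) : ¬ PowerSeries.X ^ j ∣ s := by
  intro hdvd
  obtain ⟨w, hw, hdeg⟩ := exists_norm_polynomial hb
  have hw0 : w ≠ 0 := by
    rintro rfl
    exact prod_galois_ne_zero hb0 (by rw [← hw, map_zero])
  choose f hf using fun g : Gal(E/RatFunc κ) =>
    hexp.exists_powerSeries (galois_integralOver g hb.1)
  have hprod : ((taylor t₀ w : κ[X]) : PowerSeries κ) = ∏ g, f g := by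
    apply IsFractionRing.injective (PowerSeries κ) (LaurentSeries κ)
    rw [← hexp.map_aeval, hw, map_prod, map_prod]
    exact Finset.prod_congr rfl fun g _ => hf g
  have hone : f 1 = s := by
    apply IsFractionRing.injective (PowerSeries κ) (LaurentSeries κ)
    rw [← hf, ← hs]; rfl
  have h1 : (X - C t₀) ^ j ∣ w := by
    apply X_sub_C_pow_dvd
    rw [hprod]
    exact (hone ▸ hdvd).trans (Finset.dvd_prod_of_mem f (Finset.mem_univ 1))
  have := natDegree_le_of_dvd h1 hw0
  rw [natDegree_pow, natDegree_X_sub_C] at this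
  omega

end Expansion


/-- A relation between power series with coefficients in `q`-th powers specialises, modulo `X ^ q`,
to a relation with constant coefficients. -/
lemma exists_X_pow_dvd_of_sum_mul_pow_eq_zero {κ : Type*} [Field κ] (p : ℕ) [ExpChar κ p]
    {ι : Type*} [Fintype ι] (s w : ι → PowerSeries κ) (a : ℕ)
    (h : ∑ i, s i * w i ^ p ^ a = 0) (hw : w ≠ 0) :
    ∃ c : ι → κ, c ≠ 0 ∧ PowerSeries.X ^ p ^ a ∣ ∑ i, PowerSeries.C (c i) * s i := by
  classical
  obtain ⟨i₀, hi₀⟩ := Function.ne_iff.1 hw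
  have hex : ∃ e, ¬ ∀ i, PowerSeries.X ^ (e + 1) ∣ w i := by
    obtain ⟨n, hn⟩ : ∃ n, PowerSeries.coeff n (w i₀) ≠ 0 := by
      by_contra! hcon
      exact hi₀ (PowerSeries.ext fun n => by simpa using hcon n)
    exact ⟨n, fun hall => hn (PowerSeries.X_pow_dvd_iff.1 (hall i₀) n (Nat.lt_succ_self n))⟩
  set e := Nat.find hex with he
  have hdvd : ∀ i, PowerSeries.X ^ e ∣ w i := by
    rcases Nat.eq_zero_or_pos e with h0 | hpos
    · intro i; rw [h0, pow_zero]; exact one_dvd _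
    · have := Nat.find_min hex (m := e - 1) (by omega)
      rw [not_not, Nat.sub_add_cancel hpos] at this
      exact this
  choose v hv using hdvd
  have hv0 : ∑ i, s i * v i ^ p ^ a = 0 := by
    have hX : (PowerSeries.X : PowerSeries κ) ^ (e * p ^ a) ≠ 0 :=
      pow_ne_zero _ PowerSeries.X_ne_zero
    refine (mul_eq_zero.1 ?_).resolve_left hX
    rw [Finset.mul_sum, ← h]
    refine Finset.sum_congr rfl fun i _ => ?_
    rw [hv i, mul_pow, pow_mul]
    ring
  have hchar : ExpChar (PowerSeries κ) p :=
    expChar_of_injective_ringHom (PowerSeries.C_injective (R := κ)) p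
  refine ⟨fun i => PowerSeries.constantCoeff (v i) ^ p ^ a, ?_, ?_⟩
  · intro hc
    refine Nat.find_spec hex fun i => ?_
    have : PowerSeries.constantCoeff (v i) = 0 :=
      pow_eq_zero_iff (expChar_pow_pos κ p a).ne' |>.1 (congrFun hc i)
    rw [hv i, pow_succ]
    exact mul_dvd_mul_left _ (PowerSeries.X_dvd_iff.2 this)
  · choose u hu using fun i => PowerSeries.X_dvd_iff.2
      (show PowerSeries.constantCoeff (v i - PowerSeries.C (PowerSeries.constantCoeff (v i))) = 0
        by simp)
    have hvi : ∀ i, v i ^ p ^ a = PowerSeries.C (PowerSeries.constantCoeff (v i) ^ p ^ a) +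
        PowerSeries.X ^ p ^ a * u i ^ p ^ a := by
      intro i
      rw [← mul_pow, ← hu i, map_pow, ← add_pow_expChar_pow, add_sub_cancel]
    refine ⟨-∑ i, s i * u i ^ p ^ a, ?_⟩
    simp only [hvi, mul_add, Finset.sum_add_distrib] at hv0
    rw [mul_neg, Finset.mul_sum, eq_neg_iff_add_eq_zero, ← hv0]
    congr 1 <;> exact Finset.sum_congr rfl fun i _ => by ring

section Dimension

variable {κ : Type*} [Field κ] {E : Type*} [Field E] [Algebra (RatFunc κ) E] [Algebra κ E]
  {t₀ : κ} {ι : E →+* LaurentSeries κ}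

lemma IsExpansion.coeff_smul (hexp : IsExpansion t₀ ι) (c : κ) (b : E) (n : ℤ) :
    (ι (c • b)).coeff n = c * (ι b).coeff n := by
  rw [Algebra.smul_def, map_mul, hexp.map_const, LaurentSeries.coe_algebraMap,
    HahnSeries.ofPowerSeries_C, HahnSeries.C_mul_eq_smul, HahnSeries.coeff_smul, smul_eq_mul]

variable [IsScalarTower κ (RatFunc κ) E] [FiniteDimensional (RatFunc κ) E]

/-- The spaces of functions with bounded poles are large. -/
lemma exists_le_finrank_boundedPoles :
    ∃ c : ℕ, ∀ ℓ, FiniteDimensional κ (boundedPoles κ (tvar κ E) ℓ) →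
      (ℓ + 1 - c) * Module.finrank (RatFunc κ) E ≤
        Module.finrank κ (boundedPoles κ (tvar κ E) ℓ) := by
  classical
  let e := Module.finBasis (RatFunc κ) E
  have h_int : ∀ j, ∃ a : κ[X], a ≠ 0 ∧ IntegralOver κ (tvar κ E) (aeval (tvar κ E) a * e j) := by
    intro j
    let _ : Algebra κ[X] E := (aeval (tvar κ E) : κ[X] →ₐ[κ] E).toRingHom.toAlgebra
    have : IsScalarTower κ[X] (RatFunc κ) E := IsScalarTower.of_algebraMap_eq fun w =>
      aeval_tvar w
    have halg : IsAlgebraic κ[X] (e j) :=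
      (IsFractionRing.isAlgebraic_iff κ[X] (RatFunc κ) E).2
        (Algebra.IsAlgebraic.isAlgebraic (R := RatFunc κ) (e j))
    obtain ⟨a, ha, hai⟩ := halg.exists_integral_multiple
    refine ⟨a, ha, ?_⟩
    rw [Algebra.smul_def] at hai
    exact hai
  choose a ha hai using h_int
  choose d hd using fun j => (hai j).exists_mem_boundedPoles tvar_ne_zero
  refine ⟨Finset.univ.sup d, fun ℓ hfin => ?_⟩
  set c := Finset.univ.sup d
  have hmem : ∀ x : Fin (ℓ + 1 - c) × Fin (Module.finrank (RatFunc κ) E),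
      tvar κ E ^ (x.1 : ℕ) * (aeval (tvar κ E) (a x.2) * e x.2) ∈ boundedPoles κ (tvar κ E) ℓ := by
    intro x
    have h1 : d x.2 ≤ c := Finset.le_sup (Finset.mem_univ _)
    have h2 := x.1.2
    exact boundedPoles_mono (by omega)
      (mul_mem_boundedPoles (pow_self_mem_boundedPoles tvar_ne_zero (le_refl (x.1 : ℕ))) (hd x.2))
  have hlin : LinearIndependent κ fun x : Fin (ℓ + 1 - c) × Fin (Module.finrank (RatFunc κ) E) =>
      tvar κ E ^ (x.1 : ℕ) * (aeval (tvar κ E) (a x.2) * e x.2) := by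
    have h1 : LinearIndependent κ fun i : Fin (ℓ + 1 - c) => (RatFunc.X : RatFunc κ) ^ (i : ℕ) := by
      have hX : LinearIndependent κ fun i : ℕ => (X : κ[X]) ^ i := by
        have := (Polynomial.basisMonomials κ).linearIndependent
        simpa [coe_basisMonomials, monomial_one_right_eq_X_pow] using this
      have := (hX.comp (fun i : Fin (ℓ + 1 - c) => (i : ℕ)) Fin.val_injective).map'
        (IsScalarTower.toAlgHom κ κ[X] (RatFunc κ)).toLinearMap
        (LinearMap.ker_eq_bot.2 (IsFractionRing.injective κ[X] (RatFunc κ)))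
      simpa [Function.comp_def] using this
    have h2 : LinearIndependent (RatFunc κ) fun j => aeval (tvar κ E) (a j) * e j := by
      have := e.linearIndependent.units_smul fun j => Units.mk0 (algebraMap κ[X] (RatFunc κ) (a j))
        (by simpa using ha j)
      convert this using 1
      funext j
      simp [aeval_tvar, Units.smul_def, Algebra.smul_def]
    have h3 := linearIndependent_smul h1 h2
    convert h3 using 1
    funext x
    simp [tvar, Algebra.smul_def]
  have hlin' : LinearIndependent κ fun x => (⟨_, hmem x⟩ : boundedPoles κ (tvar κ E) ℓ) :=
    LinearIndependent.of_comp (boundedPoles κ (tvar κ E) ℓ).subtype hlin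
  simpa using hlin'.fintype_card_le_finrank

variable [IsGalois (RatFunc κ) E]

lemma IsExpansion.eq_zero_of_coeff (hexp : IsExpansion t₀ ι) {b : E} {ℓ n : ℕ}
    (hb : b ∈ boundedPoles κ (tvar κ E) ℓ) (hn : ℓ * Nat.card Gal(E/RatFunc κ) < n)
    (h : ∀ i : Fin n, (ι b).coeff (i : ℤ) = 0) : b = 0 := by
  by_contra hb0
  obtain ⟨s, hs⟩ := hexp.exists_powerSeries hb.1
  refine not_X_pow_dvd hexp hb hb0 hs hn (PowerSeries.X_pow_dvd_iff.2 fun m hm => ?_)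
  have := h ⟨m, hm⟩
  rwa [hs, LaurentSeries.coe_algebraMap, LaurentSeries.coeff_coe_powerSeries] at this

lemma IsExpansion.finiteDimensional (hexp : IsExpansion t₀ ι) (ℓ : ℕ) :
    FiniteDimensional κ (boundedPoles κ (tvar κ E) ℓ) := by
  let f : boundedPoles κ (tvar κ E) ℓ →ₗ[κ] (Fin (ℓ * Nat.card Gal(E/RatFunc κ) + 1) → κ) :=
    { toFun := fun b i => (ι (b : E)).coeff (i : ℤ)
      map_add' := fun b c => by ext i; simp
      map_smul' := fun c b => by ext i; simp [hexp.coeff_smul] }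
  refine FiniteDimensional.of_injective f ((injective_iff_map_eq_zero f).2 fun b hb => ?_)
  exact Subtype.ext (hexp.eq_zero_of_coeff b.2 (Nat.lt_succ_self _) fun i => congrFun hb i)

/-- Functions with few poles which are independent over the constants are independent over the
field of `p ^ a`-th powers. -/
lemma IsExpansion.eq_zero_of_sum_mul_pow (hexp : IsExpansion t₀ ι) (p : ℕ) [ExpChar κ p]
    {I : Type*} [Fintype I] {s w : I → E} {ℓ a : ℕ} (hs : LinearIndependent κ s)
    (hsV : ∀ i, s i ∈ boundedPoles κ (tvar κ E) ℓ) (hw : ∀ i, IntegralOver κ (tvar κ E) (w i))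
    (hℓ : ℓ * Nat.card Gal(E/RatFunc κ) < p ^ a) (h : ∑ i, s i * w i ^ p ^ a = 0) : w = 0 := by
  by_contra hw0
  choose S hS using fun i => hexp.exists_powerSeries (hsV i).1
  choose W hW using fun i => hexp.exists_powerSeries (hw i)
  have hsum : ∑ i, S i * W i ^ p ^ a = 0 := by
    apply IsFractionRing.injective (PowerSeries κ) (LaurentSeries κ)
    have := congrArg ι h
    simpa [hS, hW] using this
  have hW0 : W ≠ 0 := by
    rintro rfl
    refine hw0 (funext fun i => ι.injective ?_)
    rw [hW]; simp
  obtain ⟨c, hc0, hc⟩ := exists_X_pow_dvd_of_sum_mul_pow_eq_zero p S W a hsum hW0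
  have hmem : ∑ i, c i • s i ∈ boundedPoles κ (tvar κ E) ℓ :=
    Submodule.sum_mem _ fun i _ => Submodule.smul_mem _ _ (hsV i)
  have hne : ∑ i, c i • s i ≠ 0 := fun h0 =>
    hc0 (funext fun i => Fintype.linearIndependent_iff.1 hs c h0 i)
  refine not_X_pow_dvd hexp hmem hne (s := ∑ i, PowerSeries.C (c i) * S i) ?_ hℓ hc
  simp [Algebra.smul_def, hS, hexp.map_const]

end Dimension


section Core

variable {κ : Type*} [Field κ] {E : Type*} [Field E] [Algebra (RatFunc κ) E] [Algebra κ E]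
  {t₀ : κ} {ι : E →+* LaurentSeries κ}

/-- The value of an integral function at the centre of an expansion is multiplicative. -/
lemma IsExpansion.exists_residue (hexp : IsExpansion t₀ ι) :
    ∃ (R : Subring E) (v : R →+* κ), (∀ b, IntegralOver κ (tvar κ E) b → b ∈ R) ∧
      ∀ b : R, v b = (ι b).coeff 0 := by
  let R : Subring E := (algebraMap (PowerSeries κ) (LaurentSeries κ)).range.comap ι
  have hinj := IsFractionRing.injective (PowerSeries κ) (LaurentSeries κ)
  let e : PowerSeries κ ≃+* (algebraMap (PowerSeries κ) (LaurentSeries κ)).range :=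
    RingEquiv.ofBijective _ ⟨fun x y h => hinj (congrArg Subtype.val h),
      RingHom.rangeRestrict_surjective _⟩
  let r : R →+* (algebraMap (PowerSeries κ) (LaurentSeries κ)).range :=
    ι.restrict _ _ fun x hx => hx
  refine ⟨R, (PowerSeries.constantCoeff (R := κ)).comp
    ((e.symm : _ →+* PowerSeries κ).comp r), fun b hb => ?_, fun b => ?_⟩
  · obtain ⟨s, hs⟩ := hexp.exists_powerSeries hb
    exact ⟨s, hs.symm⟩
  · have h : (algebraMap (PowerSeries κ) (LaurentSeries κ)) (e.symm (r b)) = ι b :=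
      congrArg Subtype.val (e.apply_symm_apply (r b))
    rw [← h, coeff_zero_algebraMap]
    rfl

variable [IsScalarTower κ (RatFunc κ) E] [FiniteDimensional (RatFunc κ) E]
  [IsGalois (RatFunc κ) E]

/-- Stepanov's method: the number of pairs `(t₀, h)` at which the semilinear automorphism `ρ` acts
as the `p ^ (a + b)`-th power is bounded. -/
lemma IsExpansion.card_frobenius_le (hexp : IsExpansion t₀ ι) (ι' : κ → E →+* LaurentSeries κ)
    (p : ℕ) [ExpChar κ p] [PerfectRing κ p] {a b ℓ m : ℕ} (ρ : E ≃+* E)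
    (hρt : ρ (tvar κ E) = tvar κ E)
    (hρ : ∀ x, ρ (algebraMap κ E x) = algebraMap κ E (x ^ p ^ (a + b)))
    (S : Finset (κ × Gal(E/RatFunc κ)))
    (hS : ∀ x ∈ S, IsExpansion x.1 (ι' x.1) ∧ ∀ y, IntegralOver κ (tvar κ E) y →
      (ι' x.1 (x.2 (ρ y))).coeff 0 = (ι' x.1 (x.2 y)).coeff 0 ^ p ^ (a + b))
    (hℓ : ℓ * Nat.card Gal(E/RatFunc κ) < p ^ a)
    (hdim : (ℓ * p ^ b + m) * Nat.card Gal(E/RatFunc κ) + 1 <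
      Module.finrank κ (boundedPoles κ (tvar κ E) ℓ) *
        Module.finrank κ (boundedPoles κ (tvar κ E) m)) :
    S.card ≤ (ℓ + m * p ^ a) * Nat.card Gal(E/RatFunc κ) := by
  classical
  have := hexp.finiteDimensional ℓ
  have := hexp.finiteDimensional m
  set V := boundedPoles κ (tvar κ E) ℓ
  set W := boundedPoles κ (tvar κ E) m
  set n := (ℓ * p ^ b + m) * Nat.card Gal(E/RatFunc κ) + 1 with hn
  let e := Module.finBasis κ V
  let s : Fin (Module.finrank κ V) → E := fun i => e i
  have hs : LinearIndependent κ s := e.linearIndependent.map' V.subtype V.ker_subtype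
  have hsV : ∀ i, s i ∈ V := fun i => (e i).2
  let T : (Fin (Module.finrank κ V) → W) →ₗ[κ] (Fin n → κ) :=
    { toFun := fun u i => (ι (∑ j, s j ^ p ^ b * (u j : E))).coeff (i : ℤ)
      map_add' := fun u v => by
        ext i
        simp [mul_add, Finset.sum_add_distrib]
      map_smul' := fun c u => by
        ext i
        simp only [Pi.smul_apply, Submodule.coe_smul, mul_smul_comm, ← Finset.smul_sum,
          hexp.coeff_smul, smul_eq_mul, RingHom.id_apply] }
  have hker : LinearMap.ker T ≠ ⊥ := by
    apply LinearMap.ker_ne_bot_of_finrank_lt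
    simpa [Module.finrank_pi_fintype] using hdim
  obtain ⟨u, hu, hu0⟩ := (Submodule.ne_bot_iff _).1 hker
  have hchar : ExpChar E p := expChar_of_injective_ringHom (algebraMap κ E).injective p
  have husum : ∑ j, s j ^ p ^ b * (u j : E) = 0 := by
    refine hexp.eq_zero_of_coeff (ℓ := ℓ * p ^ b + m) (n := n) (Submodule.sum_mem _ fun j _ =>
      mul_mem_boundedPoles (pow_mem_boundedPoles (hsV j) _) (u j).2) (Nat.lt_succ_self _)
      fun i => ?_
    exact congrFun (LinearMap.mem_ker.1 hu) i
  let f : κ →+* κ := ((iterateFrobeniusEquiv κ p (a + b)).symm : κ →+* κ)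
  have hρs : ∀ x, ρ.symm (algebraMap κ E x) = algebraMap κ E (f x) := by
    intro x
    rw [RingEquiv.symm_apply_eq, hρ]
    congr 1
    exact ((iterateFrobeniusEquiv κ p (a + b)).apply_symm_apply x).symm
  have hρst : ρ.symm (tvar κ E) = tvar κ E := by rw [RingEquiv.symm_apply_eq, hρt]
  let v : Fin (Module.finrank κ V) → E := fun j => ρ.symm (u j)
  have hv : ∀ j, v j ∈ W := fun j =>
    map_mem_boundedPoles (u j).2 (ρ.symm : E →+* E) f hρs hρst
  have hv0 : v ≠ 0 := by
    intro h0
    refine hu0 (funext fun j => Subtype.ext ?_)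
    have := congrFun h0 j
    simpa [v] using this
  have hB : ∑ j, s j * v j ^ p ^ a ≠ 0 := fun h0 =>
    hv0 (hexp.eq_zero_of_sum_mul_pow p hs hsV (fun j => (hv j).1) hℓ h0)
  have hBmem : ∑ j, s j * v j ^ p ^ a ∈ boundedPoles κ (tvar κ E) (ℓ + m * p ^ a) :=
    Submodule.sum_mem _ fun j _ => mul_mem_boundedPoles (hsV j) (pow_mem_boundedPoles (hv j) _)
  refine card_zeros_le ι' hBmem hB S fun x hx => ⟨(hS x hx).1, ?_⟩
  obtain ⟨R, val, hR, hval⟩ := (hS x hx).1.exists_residue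
  have hgal : ∀ {y}, IntegralOver κ (tvar κ E) y → x.2 y ∈ R := fun hy =>
    hR _ (galois_integralOver x.2 hy)
  let s' : Fin (Module.finrank κ V) → R := fun j => ⟨x.2 (s j), hgal (hsV j).1⟩
  let v' : Fin (Module.finrank κ V) → R := fun j => ⟨x.2 (v j), hgal (hv j).1⟩
  let u' : Fin (Module.finrank κ V) → R := fun j => ⟨x.2 (u j), hgal (u j).2.1⟩
  have huv : ∀ j, val (u' j) = val (v' j) ^ p ^ (a + b) := by
    intro j
    rw [hval, hval, ← (hS x hx).2 _ (hv j).1]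
    simp [u', v]
  have h1 : ∑ j, s' j ^ p ^ b * u' j = 0 := by
    apply Subtype.ext
    have := congrArg x.2 husum
    simpa [s', u'] using this
  have h2 : x.2 (∑ j, s j * v j ^ p ^ a) = ((∑ j, s' j * v' j ^ p ^ a : R) : E) := by
    simp [s', v']
  rw [h2, ← hval]
  refine (pow_eq_zero_iff (expChar_pow_pos κ p b).ne').1 ?_
  rw [map_sum, sum_pow_char_pow]
  rw [← map_zero val, ← h1, map_sum]
  refine Finset.sum_congr rfl fun j _ => ?_
  rw [map_mul, map_mul, huv, map_pow, map_pow, mul_pow, ← pow_mul, ← pow_add]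

end Core


lemma exists_stepanov_parameters {A B c r : ℕ} (hr : 0 < r) (hBA : B ≤ A)
    (hA : (2 * c + 1) * r + 1 + c * r * ((c + 1) * r) < A) :
    ∃ ℓ m : ℕ, ℓ * r < A ∧
      (ℓ * B + m) * r + 1 < (ℓ + 1 - c) * r * ((m + 1 - c) * r) ∧
      (ℓ + m * A) * r ≤ A * B + ((2 * c + 1) * r + 1) * A := by
  obtain ⟨A, rfl⟩ : ∃ A', A = A' + 1 := ⟨A - 1, by omega⟩
  have h1 := Nat.div_mul_le_self A r
  have h2 := Nat.lt_div_mul_add (a := A) hr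
  have h3 := Nat.div_mul_le_self B r
  have h4 := Nat.lt_div_mul_add (a := B) hr
  generalize A / r = ℓ at *
  generalize B / r = v at *
  refine ⟨ℓ, v + (2 * c + 1), by omega, ?_, ?_⟩
  · obtain ⟨x, hx⟩ : ∃ x, ℓ + 1 = c + x := by
      refine ⟨ℓ + 1 - c, ?_⟩
      have : c < ℓ + 1 := by
        by_contra! hcon
        have : (ℓ + 1) * r ≤ c * r := Nat.mul_le_mul_right r hcon
        nlinarith
      omega
    have hx' : ℓ + 1 - c = x := by omega
    have hy' : v + (2 * c + 1) + 1 - c = v + 1 + (c + 1) := by omega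
    rw [hx', hy']
    have e1 : A + 1 ≤ x * r + c * r := by
      have : (ℓ + 1) * r = (c + x) * r := by rw [hx]
      nlinarith
    have e2 : B + (c + 1) * r ≤ (v + 1 + (c + 1)) * r := by nlinarith
    have e3 : (ℓ * B + (v + (2 * c + 1))) * r ≤ A * B + B + (2 * c + 1) * r := by
      nlinarith [Nat.mul_le_mul_right B h1]
    have e4 : x * r * (B + (c + 1) * r) ≤ x * r * ((v + 1 + (c + 1)) * r) :=
      Nat.mul_le_mul_left _ e2
    have e5 : (A + 1) * (B + (c + 1) * r) ≤ (x * r + c * r) * (B + (c + 1) * r) :=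
      Nat.mul_le_mul_right _ e1
    have e6 : c * r * B ≤ c * r * (A + 1) := Nat.mul_le_mul_left _ hBA
    have e7 : 1 * (A + 1) ≤ r * (A + 1) := Nat.mul_le_mul_right _ hr
    nlinarith
  · have e1 : (v * r) * (A + 1) ≤ B * (A + 1) := Nat.mul_le_mul_right _ h3
    nlinarith

variable {κ : Type*} [Field κ] {E : Type*} [Field E] [Algebra (RatFunc κ) E] [Algebra κ E]
  [IsScalarTower κ (RatFunc κ) E] [FiniteDimensional (RatFunc κ) E] [IsGalois (RatFunc κ) E]

variable (κ E) in
/-- The asymptotic form of the bound obtained from Stepanov's method. -/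
lemma exists_card_frobenius_le (p : ℕ) [ExpChar κ p] [PerfectRing κ p] :
    ∃ C A₀ : ℕ, ∀ {t₀ : κ} {ι : E →+* LaurentSeries κ}, IsExpansion t₀ ι →
      ∀ (ι' : κ → E →+* LaurentSeries κ) (a b : ℕ), A₀ < p ^ a → p ^ b ≤ p ^ a →
      ∀ ρ : E ≃+* E, ρ (tvar κ E) = tvar κ E →
      (∀ x, ρ (algebraMap κ E x) = algebraMap κ E (x ^ p ^ (a + b))) →
      ∀ S : Finset (κ × Gal(E/RatFunc κ)),
      (∀ x ∈ S, IsExpansion x.1 (ι' x.1) ∧ ∀ y, IntegralOver κ (tvar κ E) y →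
        (ι' x.1 (x.2 (ρ y))).coeff 0 = (ι' x.1 (x.2 y)).coeff 0 ^ p ^ (a + b)) →
      S.card ≤ p ^ (a + b) + C * p ^ a := by
  obtain ⟨c, hc⟩ := exists_le_finrank_boundedPoles (κ := κ) (E := E)
  have hr : Nat.card Gal(E/RatFunc κ) = Module.finrank (RatFunc κ) E :=
    IsGalois.card_aut_eq_finrank _ _
  set r := Module.finrank (RatFunc κ) E
  refine ⟨(2 * c + 1) * r + 1, (2 * c + 1) * r + 1 + c * r * ((c + 1) * r),
    fun {t₀ ι} hexp ι' a b hA hBA ρ hρt hρ S hS => ?_⟩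
  obtain ⟨ℓ, m, h1, h2, h3⟩ := exists_stepanov_parameters Module.finrank_pos hBA hA
  rw [pow_add]
  refine (hexp.card_frobenius_le ι' p ρ hρt hρ S hS (ℓ := ℓ) (m := m) (by rwa [hr]) ?_).trans
    (by rwa [hr])
  rw [hr]
  exact h2.trans_le (Nat.mul_le_mul (hc ℓ (hexp.finiteDimensional ℓ))
    (hc m (hexp.finiteDimensional m)))

end StepanovBound

namespace RatIterate

section Homogeneous

variable {R : Type*} [CommRing R]

/-- The homogenization of `p` in degree `d`, evaluated at `(u, v)`. -/
def homEval (d : ℕ) (p : R[X]) (u v : R) : R :=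
  ∑ i ∈ Finset.range (d + 1), p.coeff i * u ^ i * v ^ (d - i)

lemma homEval_zero_right (d : ℕ) (p : R[X]) (u : R) : homEval d p u 0 = p.coeff d * u ^ d := by
  rw [homEval, Finset.sum_eq_single d]
  · simp
  · intro i hi hid
    rw [Finset.mem_range] at hi
    rw [zero_pow (by omega), mul_zero]
  · intro h
    simp at h

lemma homEval_of_ne_zero {K : Type*} [Field K] {d : ℕ} {p : K[X]} (hp : p.natDegree ≤ d)
    (u : K) {v : K} (hv : v ≠ 0) : homEval d p u v = v ^ d * p.eval (u / v) := by
  rw [eval_eq_sum_range' (Nat.lt_succ_of_le hp), Finset.mul_sum, homEval]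
  refine Finset.sum_congr rfl fun i hi => ?_
  rw [Finset.mem_range, Nat.lt_succ_iff] at hi
  rw [div_pow]
  field_simp
  rw [mul_assoc, ← pow_add, Nat.sub_add_cancel hi]

lemma natDegree_homEval_le (p : R[X]) (d e : ℕ) {u v : R[X]} (hu : u.natDegree ≤ e)
    (hv : v.natDegree ≤ e) : (homEval d (p.map C) u v).natDegree ≤ d * e := by
  refine natDegree_sum_le_of_forall_le _ _ fun i hi => ?_
  rw [Finset.mem_range, Nat.lt_succ_iff] at hi
  rw [coeff_map, mul_assoc]
  refine (natDegree_C_mul_le _ _).trans ((natDegree_mul_le_of_le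
    (natDegree_pow_le_of_le i hu) (natDegree_pow_le_of_le (d - i) hv)).trans ?_)
  rw [← add_mul, Nat.add_sub_cancel' hi]

lemma coeff_homEval (p : R[X]) (d e : ℕ) {u v : R[X]} (hu : u.natDegree ≤ e)
    (hv : v.natDegree ≤ e) :
    (homEval d (p.map C) u v).coeff (d * e) = homEval d p (u.coeff e) (v.coeff e) := by
  rw [homEval, finsetSum_coeff, homEval]
  refine Finset.sum_congr rfl fun i hi => ?_
  rw [Finset.mem_range, Nat.lt_succ_iff] at hi
  rw [coeff_map, mul_assoc, coeff_C_mul, mul_assoc]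
  congr 1
  have h1 : d * e = i * e + (d - i) * e := by rw [← add_mul, Nat.add_sub_cancel' hi]
  rw [h1, coeff_mul_add_eq_of_natDegree_le (natDegree_pow_le_of_le i hu)
    (natDegree_pow_le_of_le (d - i) hv), coeff_pow_of_natDegree_le hu,
    coeff_pow_of_natDegree_le hv]

end Homogeneous

variable {K : Type*} [Field K] {p q : K[X]}

lemma homEval_ne_zero (hco : IsCoprime p q) (hd : 0 < max p.natDegree q.natDegree) {u v : K}
    (huv : u ≠ 0 ∨ v ≠ 0) : homEval (max p.natDegree q.natDegree) p u v ≠ 0 ∨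
      homEval (max p.natDegree q.natDegree) q u v ≠ 0 := by
  by_cases hv : v = 0
  · subst hv
    have hu : u ≠ 0 := by simpa using huv
    simp only [homEval_zero_right, ne_eq, mul_eq_zero, pow_eq_zero_iff', hu, false_and, or_false]
    rcases le_total p.natDegree q.natDegree with h | h
    · rw [max_eq_right h] at hd ⊢
      right
      rw [coeff_natDegree, leadingCoeff_eq_zero]
      rintro rfl
      simp at hd
    · rw [max_eq_left h] at hd ⊢
      left
      rw [coeff_natDegree, leadingCoeff_eq_zero]
      rintro rfl
      simp at hd
  · rw [homEval_of_ne_zero (le_max_left _ _) u hv, homEval_of_ne_zero (le_max_right _ _) u hv]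
    by_contra! hcon
    obtain ⟨a, b, hab⟩ := hco
    have := congrArg (eval (u / v)) hab
    have hvd := pow_ne_zero (max p.natDegree q.natDegree) hv
    have h1 := (mul_eq_zero.1 hcon.1).resolve_left hvd
    have h2 := (mul_eq_zero.1 hcon.2).resolve_left hvd
    simp [h1, h2] at this

variable (p q) in
lemma iterPair_succ (n : ℕ) : iterPair p q (n + 1) =
    (homEval (max p.natDegree q.natDegree) (p.map C) (iterPair p q n).1 (iterPair p q n).2,
     homEval (max p.natDegree q.natDegree) (q.map C) (iterPair p q n).1 (iterPair p q n).2) := by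
  simp [iterPair, pairComp, homEval]

variable (p q) in
lemma eval_iterPair_succ (n : ℕ) (x : K) :
    (iterPair p q (n + 1)).1.eval x = homEval (max p.natDegree q.natDegree) p
      ((iterPair p q n).1.eval x) ((iterPair p q n).2.eval x) ∧
    (iterPair p q (n + 1)).2.eval x = homEval (max p.natDegree q.natDegree) q
      ((iterPair p q n).1.eval x) ((iterPair p q n).2.eval x) := by
  simp [iterPair, pairComp, homEval, eval_finsetSum]

lemma eval_iterPair_ne_zero (hco : IsCoprime p q) (hd : 0 < max p.natDegree q.natDegree)
    (n : ℕ) (x : K) : (iterPair p q n).1.eval x ≠ 0 ∨ (iterPair p q n).2.eval x ≠ 0 := by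
  induction n with
  | zero => simp [iterPair]
  | succ n ih =>
    rw [(eval_iterPair_succ p q n x).1, (eval_iterPair_succ p q n x).2]
    exact homEval_ne_zero hco hd ih

variable (p q) in
lemma natDegree_iterPair_le (n : ℕ) :
    (iterPair p q n).1.natDegree ≤ max p.natDegree q.natDegree ^ n ∧
    (iterPair p q n).2.natDegree ≤ max p.natDegree q.natDegree ^ n := by
  induction n with
  | zero => simp [iterPair, natDegree_X]
  | succ n ih =>
    rw [iterPair_succ, pow_succ']
    exact ⟨natDegree_homEval_le _ _ _ ih.1 ih.2, natDegree_homEval_le _ _ _ ih.1 ih.2⟩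

lemma coeff_iterPair_ne_zero (hco : IsCoprime p q) (hd : 0 < max p.natDegree q.natDegree)
    (n : ℕ) : (iterPair p q n).1.coeff (max p.natDegree q.natDegree ^ n) ≠ 0 ∨
      (iterPair p q n).2.coeff (max p.natDegree q.natDegree ^ n) ≠ 0 := by
  induction n with
  | zero => simp [iterPair]
  | succ n ih =>
    have h := natDegree_iterPair_le p q n
    rw [iterPair_succ, pow_succ', coeff_homEval _ _ _ h.1 h.2, coeff_homEval _ _ _ h.1 h.2]
    exact homEval_ne_zero hco hd ih

open Classical in
/-- The point of the projective line with homogeneous coordinates `(u, v)`. -/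
noncomputable def toP1 (u v : K) : Option K := if v = 0 then none else some (u / v)

lemma toP1_zero (u : K) : toP1 u 0 = none := if_pos rfl

lemma toP1_of_ne_zero (u : K) {v : K} (hv : v ≠ 0) : toP1 u v = some (u / v) := if_neg hv

lemma toP1_mul_left {c : K} (hc : c ≠ 0) (u v : K) : toP1 (c * u) (c * v) = toP1 u v := by
  by_cases hv : v = 0
  · rw [hv, mul_zero, toP1_zero, toP1_zero]
  · rw [toP1_of_ne_zero _ hv, toP1_of_ne_zero _ (mul_ne_zero hc hv), mul_div_mul_left _ _ hc]

lemma ratMapP1_some (x : K) : ratMapP1 p q (some x) = toP1 (p.eval x) (q.eval x) := by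
  simp [ratMapP1, toP1]

lemma ratMapP1_none (hd : 0 < max p.natDegree q.natDegree) : ratMapP1 p q none =
    toP1 (p.coeff (max p.natDegree q.natDegree)) (q.coeff (max p.natDegree q.natDegree)) := by
  rcases lt_trichotomy p.natDegree q.natDegree with h | h | h
  · have hq : q.leadingCoeff ≠ 0 := by
      rw [Ne, leadingCoeff_eq_zero]
      rintro rfl
      simp at h
    rw [max_eq_right h.le, coeff_natDegree, toP1_of_ne_zero _ hq,
      coeff_eq_zero_of_natDegree_lt h, zero_div]
    simp [ratMapP1, h, h.le]
  · have hq : q.leadingCoeff ≠ 0 := by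
      rw [Ne, leadingCoeff_eq_zero]
      rintro rfl
      simp [h] at hd
    rw [h, max_self, coeff_natDegree, toP1_of_ne_zero _ hq, ← h]
    simp only [ratMapP1, h, lt_irrefl, if_false]
    rw [← h, coeff_natDegree]
  · rw [max_eq_left h.le, coeff_eq_zero_of_natDegree_lt h, toP1_zero]
    simp [ratMapP1, h]

lemma ratMapP1_toP1 (hd : 0 < max p.natDegree q.natDegree) {u v : K} (huv : u ≠ 0 ∨ v ≠ 0) :
    ratMapP1 p q (toP1 u v) = toP1 (homEval (max p.natDegree q.natDegree) p u v)
      (homEval (max p.natDegree q.natDegree) q u v) := by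
  by_cases hv : v = 0
  · subst hv
    have hu : u ≠ 0 := by simpa using huv
    rw [homEval_zero_right, homEval_zero_right, toP1_zero, ratMapP1_none hd,
      mul_comm (p.coeff _), mul_comm (q.coeff _), toP1_mul_left (pow_ne_zero _ hu)]
  · rw [homEval_of_ne_zero (le_max_left _ _) u hv, homEval_of_ne_zero (le_max_right _ _) u hv,
      toP1_of_ne_zero _ hv, ratMapP1_some, toP1_mul_left (pow_ne_zero _ hv)]

lemma iterate_ratMapP1 (hco : IsCoprime p q) (hd : 0 < max p.natDegree q.natDegree)
    (n : ℕ) (x : K) : (ratMapP1 p q)^[n] (some x) =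
      toP1 ((iterPair p q n).1.eval x) ((iterPair p q n).2.eval x) := by
  induction n with
  | zero => simp [iterPair, toP1]
  | succ n ih =>
    rw [Function.iterate_succ_apply', ih, ratMapP1_toP1 hd (eval_iterPair_ne_zero hco hd n x),
      (eval_iterPair_succ p q n x).1, (eval_iterPair_succ p q n x).2]


section Specialization

variable {K : Type*} [Field K]

/-- The specialisation of `u - t v` at `t = t₀` is separable of full degree `D`. -/
def IsGoodAt (u v : K[X]) (D : ℕ) (t₀ : K) : Prop :=
  (u - C t₀ * v).natDegree = D ∧ (u - C t₀ * v).Separable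

lemma finite_not_isGoodAt [IsAlgClosed K] {u v : K[X]} {D : ℕ}
    (huv : ∀ x, u.eval x ≠ 0 ∨ v.eval x ≠ 0) (hu : u.natDegree ≤ D) (hv : v.natDegree ≤ D)
    (hD : u.coeff D ≠ 0 ∨ v.coeff D ≠ 0) (hD0 : (D : K) ≠ 0) :
    {t₀ | ¬ IsGoodAt u v D t₀}.Finite := by
  have hco : IsCoprime u v := by
    rw [isCoprime_iff_aeval_ne_zero_of_isAlgClosed K K]
    simpa using huv
  have hDpos : 0 < D := Nat.pos_of_ne_zero (by rintro rfl; simp at hD0)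
  have hder : ∀ w : K[X], w.coeff D ≠ 0 → derivative w ≠ 0 := by
    intro w hw h0
    have := coeff_derivative w (D - 1)
    rw [h0, coeff_zero, Nat.sub_add_cancel hDpos] at this
    have h1 : ((D - 1 : ℕ) : K) + 1 = D := by
      rw [← Nat.cast_succ, Nat.succ_eq_add_one, Nat.sub_add_cancel hDpos]
    rw [h1] at this
    exact mul_ne_zero hw hD0 this.symm
  have hW : wronskian u v ≠ 0 := by
    rw [Ne, hco.wronskian_eq_zero_iff]
    rintro ⟨h1, h2⟩
    exact hD.elim (fun h => hder u h h1) fun h => hder v h h2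
  refine (((wronskian u v).rootSet_finite K).image (fun x => u.eval x / v.eval x) |>.union
    (Set.finite_singleton (u.coeff D / v.coeff D))).subset fun t₀ ht₀ => ?_
  by_cases hdeg : (u - C t₀ * v).natDegree = D
  · left
    have hsep : ¬ (u - C t₀ * v).Separable := fun h => ht₀ ⟨hdeg, h⟩
    rw [Separable, isCoprime_iff_aeval_ne_zero_of_isAlgClosed K K] at hsep
    push Not at hsep
    obtain ⟨x, h1, h2⟩ := hsep
    simp only [coe_aeval_eq_eval, eval_sub, eval_mul, eval_C, derivative_sub, derivative_mul,
      derivative_C, zero_mul, zero_add, sub_eq_zero] at h1 h2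
    have hvx : v.eval x ≠ 0 := fun h0 => (huv x).elim (fun h => h (by rw [h1, h0, mul_zero]))
      fun h => h h0
    refine ⟨x, ?_, by simp only; rw [h1, mul_div_cancel_right₀ _ hvx]⟩
    rw [mem_rootSet_of_ne hW, coe_aeval_eq_eval, wronskian, eval_sub, eval_mul, eval_mul, h1, h2]
    ring
  · right
    have hle : (u - C t₀ * v).natDegree ≤ D :=
      (natDegree_sub_le _ _).trans (max_le hu ((natDegree_C_mul_le _ _).trans hv))
    have h0 : (u - C t₀ * v).coeff D = 0 := coeff_eq_zero_of_natDegree_lt (lt_of_le_of_ne hle hdeg)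
    rw [coeff_sub, coeff_C_mul, sub_eq_zero] at h0
    have hvD : v.coeff D ≠ 0 := fun h => hD.elim (fun h' => h' (by rw [h0, h, mul_zero]))
      fun h' => h' h
    rw [Set.mem_singleton_iff, h0, mul_div_cancel_right₀ _ hvD]

end Specialization

section Count

variable {F : Type*} [Field F] [Fintype F]

lemma eval_map_pow_card_pow (w : F[X]) (N : ℕ) (a : AlgebraicClosure F) :
    (w.map (algebraMap F (AlgebraicClosure F))).eval a ^ Fintype.card F ^ N =
      (w.map (algebraMap F (AlgebraicClosure F))).eval (a ^ Fintype.card F ^ N) := by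
  have h : ∀ x : AlgebraicClosure F,
      (FiniteField.frobeniusAlgHom F (AlgebraicClosure F) ^ N) x = x ^ Fintype.card F ^ N := by
    intro x
    rw [AlgHom.coe_pow, FiniteField.coe_frobeniusAlgHom, pow_iterate]
  rw [eval_map_algebraMap, eval_map_algebraMap, ← h, ← h, aeval_algHom_apply]

/-- The points of `ℙ¹(𝔽_{q^N})`. -/
def ratPoints (F : Type*) [Field F] [Fintype F] (N : ℕ) : Set (Option (AlgebraicClosure F)) :=
  {α | α = none ∨ ∃ a : AlgebraicClosure F, α = some a ∧ a ^ Fintype.card F ^ N = a}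

lemma toP1_mem_ratPoints {N : ℕ} {u v : AlgebraicClosure F} (hu : u ^ Fintype.card F ^ N = u)
    (hv : v ^ Fintype.card F ^ N = v) : toP1 u v ∈ ratPoints F N := by
  by_cases h : v = 0
  · left
    rw [h, toP1_zero]
  · right
    exact ⟨u / v, toP1_of_ne_zero _ h, by rw [div_pow, hu, hv]⟩

lemma ratMapP1_mem_ratPoints {p q : F[X]} (hd : 0 < max p.natDegree q.natDegree) {N : ℕ}
    {α : Option (AlgebraicClosure F)} (hα : α ∈ ratPoints F N) :
    ratMapP1 (p.map (algebraMap F (AlgebraicClosure F))) (q.map (algebraMap F (AlgebraicClosure F))) α ∈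
      ratPoints F N := by
  have hcoeff : ∀ x : F,
      algebraMap F (AlgebraicClosure F) x ^ Fintype.card F ^ N = algebraMap F (AlgebraicClosure F) x := by
    intro x
    rw [← map_pow, FiniteField.pow_card_pow]
  rcases hα with rfl | ⟨a, rfl, ha⟩
  · rw [ratMapP1_none (by simpa using hd), coeff_map, coeff_map]
    exact toP1_mem_ratPoints (hcoeff _) (hcoeff _)
  · rw [ratMapP1_some]
    exact toP1_mem_ratPoints (by rw [eval_map_pow_card_pow, ha]) (by rw [eval_map_pow_card_pow, ha])

/-- Periodic points are in the image of every iterate. -/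
lemma perCount_le {p q : F[X]} (hco : IsCoprime p q) (hd : 0 < max p.natDegree q.natDegree)
    (n : ℕ) {N : ℕ} (hN : N ≠ 0) {u v : (AlgebraicClosure F)[X]}
    (huv : iterPair (p.map (algebraMap F (AlgebraicClosure F))) (q.map (algebraMap F (AlgebraicClosure F))) n = (u, v)) (D : ℕ)
    (hbad : {t₀ | ¬ IsGoodAt u v D t₀}.Finite) :
    perCount F p q N ≤ {t₀ | IsGoodAt u v D t₀ ∧ t₀ ^ Fintype.card F ^ N = t₀ ∧
      ∃ x, x ^ Fintype.card F ^ N = x ∧ (u - C t₀ * v).eval x = 0}.ncard +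
      {t₀ | ¬ IsGoodAt u v D t₀}.ncard + 2 := by
  classical
  set φ := ratMapP1 (p.map (algebraMap F (AlgebraicClosure F))) (q.map (algebraMap F (AlgebraicClosure F)))
  have hcard : 1 < Fintype.card F ^ N := Nat.one_lt_pow hN Fintype.one_lt_card
  have hfin : {t₀ : (AlgebraicClosure F) | t₀ ^ Fintype.card F ^ N = t₀}.Finite := by
    refine ((X ^ Fintype.card F ^ N - X : (AlgebraicClosure F)[X]).rootSet_finite
      (AlgebraicClosure F)).subset fun t ht => ?_
    rw [mem_rootSet_of_ne (FiniteField.X_pow_card_sub_X_ne_zero (AlgebraicClosure F) hcard)]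
    simpa [sub_eq_zero] using ht
  set S := {t₀ | IsGoodAt u v D t₀ ∧ t₀ ^ Fintype.card F ^ N = t₀ ∧
      ∃ x, x ^ Fintype.card F ^ N = x ∧ (u - C t₀ * v).eval x = 0}
  set B := {t₀ | ¬ IsGoodAt u v D t₀}
  have hS : S.Finite := hfin.subset fun t ht => ht.2.1
  have hmaps : ∀ j, Set.MapsTo φ^[j] (ratPoints F N) (ratPoints F N) := fun j =>
    Set.MapsTo.iterate (fun α hα => ratMapP1_mem_ratPoints hd hα) j
  have hsub : {α : Option (AlgebraicClosure F) |
      (α = none ∨ ∃ a : AlgebraicClosure F, α = some a ∧ a ^ Fintype.card F ^ N = a) ∧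
      ∃ m : ℕ, 1 ≤ m ∧ φ^[m] α = α} ⊆ some '' (S ∪ B) ∪ {none, φ^[n] none} := by
    rintro α ⟨hα, m, hm, hmα⟩
    have hpre : φ^[n] (φ^[m * n - n] α) = α := by
      rw [← Function.iterate_add_apply, Nat.add_sub_cancel' (Nat.le_mul_of_pos_left n hm)]
      exact Function.IsPeriodicPt.mul_const (show Function.IsPeriodicPt φ m α from hmα) n
    have hβ : φ^[m * n - n] α ∈ ratPoints F N := hmaps _ hα
    generalize φ^[m * n - n] α = β at hpre hβ
    rcases hα with rfl | ⟨a, rfl, ha⟩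
    · exact Or.inr (Or.inl rfl)
    rcases hβ with rfl | ⟨x, rfl, hx⟩
    · exact Or.inr (Or.inr hpre.symm)
    left
    refine ⟨a, ?_, rfl⟩
    by_cases hga : IsGoodAt u v D a
    · refine Or.inl ⟨hga, ha, x, hx, ?_⟩
      rw [iterate_ratMapP1 ((isCoprime_map _).2 hco) (by simpa using hd), huv] at hpre
      by_cases hv : v.eval x = 0
      · simp [hv, toP1_zero] at hpre
      · rw [toP1_of_ne_zero _ hv, Option.some_inj] at hpre
        rw [eval_sub, eval_mul, eval_C, ← hpre, div_mul_cancel₀ _ hv, sub_self]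
    · exact Or.inr hga
  refine (Set.ncard_le_ncard hsub (((hS.union hbad).image _).union (Set.toFinite _))).trans ?_
  refine (Set.ncard_union_le _ _).trans (Nat.add_le_add ?_ ((Set.ncard_insert_le _ _).trans (by simp)))
  exact (Set.ncard_image_le (hS.union hbad)).trans (Set.ncard_union_le _ _)

end Count

end RatIterate

namespace StepanovBound

section FieldHoms

lemma exists_ringHom_of_splits {k E L : Type*} [Field k] [Field E] [Field L] [Algebra k E]
    (f : k[X]) [IsSplittingField k E f] (θ : k →+* L) (h : (f.map θ).Splits) :
    ∃ ι : E →+* L, ι.comp (algebraMap k E) = θ := by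
  let _ : Algebra k L := θ.toAlgebra
  exact ⟨(IsSplittingField.lift E f h : E →ₐ[k] L).toRingHom,
    (IsSplittingField.lift E f h : E →ₐ[k] L).comp_algebraMap⟩

lemma exists_galois_of_comp_eq {k E L : Type*} [Field k] [Field E] [Field L] [Algebra k E]
    [Normal k E] {ι ι' : E →+* L} (h : ι'.comp (algebraMap k E) = ι.comp (algebraMap k E)) :
    ∃ g : Gal(E/k), ∀ y, ι' y = ι (g y) := by
  let _ : Algebra E L := ι.toAlgebra
  let _ : Algebra k L := (ι.comp (algebraMap k E)).toAlgebra
  have : IsScalarTower k E L := IsScalarTower.of_algebraMap_eq fun _ => rfl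
  let φ : E →ₐ[k] L := { ι' with commutes' := fun r => congrArg (fun f => f r) h }
  exact ⟨φ.restrictNormal' E, fun y => (φ.restrictNormal_commutes E y).symm⟩

lemma splittingField_ringHom_ext {k E L : Type*} [Field k] [Field E] [Semiring L] [Algebra k E]
    (f : k[X]) [IsSplittingField k E f] {ι ι' : E →+* L}
    (h : ∀ r, ι (algebraMap k E r) = ι' (algebraMap k E r))
    (hroot : ∀ y ∈ f.rootSet E, ι y = ι' y) : ι = ι' := by
  ext y
  have hy : y ∈ Algebra.adjoin k (f.rootSet E) := by
    rw [IsSplittingField.adjoin_rootSet]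
    exact Algebra.mem_top
  induction hy using Algebra.adjoin_induction with
  | mem x hx => exact hroot x hx
  | algebraMap r => exact h r
  | add x y _ _ hx hy => rw [map_add, map_add, hx, hy]
  | mul x y _ _ hx hy => rw [map_mul, map_mul, hx, hy]

lemma ratFunc_ringHom_ext {κ L : Type*} [Field κ] [Semiring L] {θ θ' : RatFunc κ →+* L}
    (hC : ∀ x, θ (algebraMap κ (RatFunc κ) x) = θ' (algebraMap κ (RatFunc κ) x))
    (hX : θ RatFunc.X = θ' RatFunc.X) : θ = θ' := by
  refine IsLocalization.ringHom_ext (nonZeroDivisors κ[X]) (Polynomial.ringHom_ext ?_ ?_)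
  · intro x
    simpa [RatFunc.algebraMap_C, RatFunc.algebraMap_eq_C] using hC x
  · simpa [RatFunc.algebraMap_X] using hX

end FieldHoms

section Hensel

variable {κ : Type*} [Field κ]

lemma exists_powerSeries_root {g : (PowerSeries κ)[X]} (hlead : IsUnit g.leadingCoeff) {x : κ}
    (hx : (g.map PowerSeries.constantCoeff).eval x = 0)
    (hx' : (derivative (g.map PowerSeries.constantCoeff)).eval x ≠ 0) :
    ∃ y : PowerSeries κ, g.eval y = 0 ∧ PowerSeries.constantCoeff y = x := by
  obtain ⟨c, hc⟩ := hlead.exists_left_inv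
  have hcu : IsUnit c := IsUnit.of_mul_eq_one _ hc
  have hmonic : (C c * g).Monic := by
    rw [Monic, leadingCoeff_mul', leadingCoeff_C, hc]
    rw [leadingCoeff_C, hc]
    exact one_ne_zero
  have heval : ∀ w : (PowerSeries κ)[X], PowerSeries.constantCoeff (w.eval (PowerSeries.C x)) =
      (w.map PowerSeries.constantCoeff).eval x := by
    intro w
    have := eval₂_at_apply (p := w) (PowerSeries.constantCoeff (R := κ)) (PowerSeries.C x)
    rw [← this, eval_map]
    simp
  obtain ⟨y, hy, hyx⟩ := HenselianRing.is_henselian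
    (I := Ideal.span {(PowerSeries.X : PowerSeries κ)}) (C c * g) hmonic (PowerSeries.C x) (by
      rw [Ideal.mem_span_singleton, PowerSeries.X_dvd_iff, heval, Polynomial.map_mul, eval_mul, hx,
        mul_zero]) (by
      apply IsUnit.map
      rw [PowerSeries.isUnit_iff_constantCoeff, heval, derivative_C_mul, Polynomial.map_mul,
        eval_mul, ← derivative_map, isUnit_iff_ne_zero]
      refine mul_ne_zero ?_ hx'
      rw [map_C, eval_C, ← isUnit_iff_ne_zero, ← PowerSeries.isUnit_iff_constantCoeff]
      exact hcu)
  refine ⟨y, ?_, ?_⟩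
  · rw [IsRoot, eval_mul, eval_C] at hy
    exact (hcu.mul_right_eq_zero).1 hy
  · rw [Ideal.mem_span_singleton, PowerSeries.X_dvd_iff, map_sub, sub_eq_zero] at hyx
    simpa using hyx

end Hensel

section Splitting

variable {κ : Type*} [Field κ]

/-- The embedding `κ(t) → κ((T))`, `t ↦ t₀ + T`. -/
noncomputable def expandAt (t₀ : κ) : RatFunc κ →+* LaurentSeries κ :=
  IsFractionRing.lift (K := RatFunc κ) (A := κ[X])
    (g := (algebraMap (PowerSeries κ) (LaurentSeries κ)).comp
      ((coeToPowerSeries.ringHom (R := κ)).comp (taylorAlgHom t₀).toRingHom))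
    ((IsFractionRing.injective (PowerSeries κ) (LaurentSeries κ)).comp
      ((Polynomial.coe_injective κ).comp (taylor_injective t₀)))

lemma expandAt_algebraMap (t₀ x : κ) : expandAt t₀ (algebraMap κ (RatFunc κ) x) =
    algebraMap (PowerSeries κ) (LaurentSeries κ) (PowerSeries.C x) := by
  rw [RatFunc.algebraMap_eq_C, ← RatFunc.algebraMap_C, expandAt, IsFractionRing.lift_algebraMap]
  simp

lemma expandAt_X (t₀ : κ) : expandAt t₀ RatFunc.X =
    algebraMap (PowerSeries κ) (LaurentSeries κ) (PowerSeries.C t₀ + PowerSeries.X) := by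
  rw [← RatFunc.algebraMap_X, expandAt, IsFractionRing.lift_algebraMap]
  simp [add_comm]

/-- The polynomial `u - t v` over `κ(t)`. -/
noncomputable def pencil (u v : κ[X]) : (RatFunc κ)[X] :=
  u.map (RatFunc.C : κ →+* RatFunc κ) - C RatFunc.X * v.map (RatFunc.C : κ →+* RatFunc κ)

lemma map_pencil_expandAt (u v : κ[X]) (t₀ : κ) : (pencil u v).map (expandAt t₀) =
    (u.map PowerSeries.C - C (PowerSeries.C t₀ + PowerSeries.X) * v.map PowerSeries.C).map
      (algebraMap (PowerSeries κ) (LaurentSeries κ)) := by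
  have h : (expandAt t₀).comp RatFunc.C =
      (algebraMap (PowerSeries κ) (LaurentSeries κ)).comp PowerSeries.C := by
    ext1 x
    rw [RingHom.comp_apply, ← RatFunc.algebraMap_eq_C, expandAt_algebraMap, RingHom.comp_apply]
  simp only [pencil, Polynomial.map_sub, Polynomial.map_mul, Polynomial.map_map, map_C, h,
    expandAt_X]

/-- At a good specialisation, the roots of the pencil are power series with distinct constant
terms. -/
lemma exists_roots_pencil [IsAlgClosed κ] {u v : κ[X]} {D : ℕ} (hu : u.natDegree ≤ D)
    (hv : v.natDegree ≤ D) {t₀ : κ} (hgood : RatIterate.IsGoodAt u v D t₀) :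
    ∃ s : κ → PowerSeries κ,
      (∀ x, (u - C t₀ * v).eval x = 0 → PowerSeries.constantCoeff (s x) = x ∧
        ((pencil u v).map (expandAt t₀)).IsRoot
          (algebraMap (PowerSeries κ) (LaurentSeries κ) (s x))) ∧
      (∀ z, ((pencil u v).map (expandAt t₀)).IsRoot z → ∃ x, (u - C t₀ * v).eval x = 0 ∧
        z = algebraMap (PowerSeries κ) (LaurentSeries κ) (s x)) ∧
      ((pencil u v).map (expandAt t₀)).Splits ∧ (pencil u v).Separable := by
  classical
  set g : (PowerSeries κ)[X] :=
    u.map PowerSeries.C - C (PowerSeries.C t₀ + PowerSeries.X) * v.map PowerSeries.C with hg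
  set f₀ := u - C t₀ * v with hf₀
  have hgmap : g.map PowerSeries.constantCoeff = f₀ := by
    have : (PowerSeries.constantCoeff (R := κ)).comp PowerSeries.C = RingHom.id κ := by
      ext; simp
    simp [hg, hf₀, Polynomial.map_map, this]
  have hgD : g.natDegree ≤ D :=
    (natDegree_sub_le _ _).trans (max_le ((natDegree_map_le).trans hu)
      ((natDegree_C_mul_le _ _).trans ((natDegree_map_le).trans hv)))
  have hgdeg : g.natDegree = D := le_antisymm hgD (by
    rw [← hgood.1, ← hf₀, ← hgmap]
    exact natDegree_map_le)
  have hf₀0 : f₀ ≠ 0 := hgood.2.ne_zero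
  have hlead : IsUnit g.leadingCoeff := by
    rw [PowerSeries.isUnit_iff_constantCoeff, leadingCoeff, hgdeg, ← coeff_map, hgmap,
      ← hgood.1, coeff_natDegree, isUnit_iff_ne_zero]
    exact leadingCoeff_ne_zero.2 hf₀0
  have hex : ∀ x, ∃ y : PowerSeries κ, f₀.eval x = 0 →
      g.eval y = 0 ∧ PowerSeries.constantCoeff y = x := by
    intro x
    by_cases hx : f₀.eval x = 0
    · obtain ⟨y, hy⟩ := exists_powerSeries_root hlead (x := x) (by rwa [hgmap]) (by
        rw [hgmap]
        intro h0
        have := (isCoprime_iff_aeval_ne_zero_of_isAlgClosed κ κ _ _).1 hgood.2 x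
        simp only [coe_aeval_eq_eval] at this
        exact this.elim (fun h => h hx) fun h => h h0)
      exact ⟨y, fun _ => hy⟩
    · exact ⟨0, fun h => absurd h hx⟩
  choose s hs using hex
  have hinj := IsFractionRing.injective (PowerSeries κ) (LaurentSeries κ)
  have hroot : ∀ x, f₀.eval x = 0 → ((pencil u v).map (expandAt t₀)).IsRoot
      (algebraMap (PowerSeries κ) (LaurentSeries κ) (s x)) := by
    intro x hx
    rw [map_pencil_expandAt, IsRoot, eval_map, eval₂_at_apply, (hs x hx).1, map_zero]
  set G := (pencil u v).map (expandAt t₀) with hG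
  have hGdeg : G.natDegree = D := by
    rw [hG, map_pencil_expandAt, natDegree_map_eq_of_injective hinj, hgdeg]
  have hG0 : G ≠ 0 := by
    rw [hG, map_pencil_expandAt, Ne, Polynomial.map_eq_zero_iff hinj]
    intro h0
    rw [hg, h0] at hlead
    simp at hlead
  set Z := f₀.roots.toFinset.image fun x => algebraMap (PowerSeries κ) (LaurentSeries κ) (s x)
  have hmemZ : ∀ x, x ∈ f₀.roots.toFinset ↔ f₀.eval x = 0 := by
    intro x
    rw [Multiset.mem_toFinset, mem_roots hf₀0, IsRoot]
  have hZcard : Z.card = D := by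
    rw [Finset.card_image_of_injOn, Multiset.toFinset_card_of_nodup (nodup_roots hgood.2),
      splits_iff_card_roots.1 (IsAlgClosed.splits f₀), hgood.1]
    intro x hx y hy hxy
    rw [Finset.mem_coe, hmemZ] at hx hy
    rw [← (hs x hx).2, ← (hs y hy).2, hinj hxy]
  have hZsub : Z ⊆ G.roots.toFinset := by
    intro z hz
    obtain ⟨x, hx, rfl⟩ := Finset.mem_image.1 hz
    rw [Multiset.mem_toFinset, mem_roots hG0]
    exact hroot x ((hmemZ x).1 hx)
  have h1 : Z.card ≤ G.roots.toFinset.card := Finset.card_le_card hZsub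
  have h2 := G.roots.toFinset_card_le
  have h3 := G.card_roots'
  have hsplit : G.Splits := splits_iff_card_roots.2 (by omega)
  have hZ : Z = G.roots.toFinset := Finset.eq_of_subset_of_card_le hZsub (by omega)
  refine ⟨s, fun x hx => ⟨(hs x hx).2, hroot x hx⟩, fun z hz => ?_, hsplit, ?_⟩
  · have : z ∈ Z := by
      rw [hZ, Multiset.mem_toFinset, mem_roots hG0]
      exact hz
    obtain ⟨x, hx, rfl⟩ := Finset.mem_image.1 this
    exact ⟨x, (hmemZ x).1 hx, rfl⟩
  · rw [← separable_map (expandAt t₀), ← nodup_roots_iff_of_splits hG0 hsplit]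
    rw [← Multiset.toFinset_card_eq_card_iff_nodup]
    omega

end Splitting


variable {κ : Type*} [Field κ] {E : Type*} [Field E] [Algebra (RatFunc κ) E] [Algebra κ E]
  [IsScalarTower κ (RatFunc κ) E]

lemma isExpansion_of_comp_eq {t₀ : κ} {ι : E →+* LaurentSeries κ}
    (h : ι.comp (algebraMap (RatFunc κ) E) = expandAt t₀) : IsExpansion t₀ ι where
  map_const x := by
    rw [IsScalarTower.algebraMap_apply κ (RatFunc κ) E, ← expandAt_algebraMap, ← h]
    rfl
  map_tvar := by
    rw [← expandAt_X, ← h]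
    rfl

lemma IsExpansion.comp_eq {t₀ : κ} {ι : E →+* LaurentSeries κ} (h : IsExpansion t₀ ι) :
    ι.comp (algebraMap (RatFunc κ) E) = expandAt t₀ := by
  refine ratFunc_ringHom_ext (fun x => ?_) ?_
  · rw [expandAt_algebraMap, ← h.map_const, IsScalarTower.algebraMap_apply κ (RatFunc κ) E]
    rfl
  · rw [expandAt_X, ← h.map_tvar]
    rfl

/-- The action of a field homomorphism on the coefficients of Laurent series. -/
noncomputable def laurentMap (f : κ →+* κ) : LaurentSeries κ →+* LaurentSeries κ :=
  IsFractionRing.lift (A := PowerSeries κ) (K := LaurentSeries κ)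
    (g := (algebraMap (PowerSeries κ) (LaurentSeries κ)).comp (PowerSeries.map f))
    ((IsFractionRing.injective (PowerSeries κ) (LaurentSeries κ)).comp
      (PowerSeries.map_injective f f.injective))

lemma laurentMap_algebraMap (f : κ →+* κ) (s : PowerSeries κ) :
    laurentMap f (algebraMap (PowerSeries κ) (LaurentSeries κ) s) =
      algebraMap (PowerSeries κ) (LaurentSeries κ) (PowerSeries.map f s) := by
  rw [laurentMap, IsFractionRing.lift_algebraMap, RingHom.comp_apply]

/-- An automorphism fixing the roots of a polynomial commutes with its Galois group. -/
lemma semilinear_comm_galois {f : (RatFunc κ)[X]} [IsSplittingField (RatFunc κ) E f]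
    (τ : κ → κ) (σ : E →+* E) (hσ : ∀ x, σ (algebraMap κ E x) = algebraMap κ E (τ x))
    (hσt : σ (tvar κ E) = tvar κ E) (hroot : ∀ y ∈ f.rootSet E, σ y = y)
    (g : Gal(E/RatFunc κ)) (y : E) : σ (g y) = g (σ y) := by
  have hk : (σ.comp (g : E →+* E)).comp (algebraMap (RatFunc κ) E) =
      ((g : E →+* E).comp σ).comp (algebraMap (RatFunc κ) E) := by
    refine ratFunc_ringHom_ext (fun x => ?_) ?_
    · simp only [RingHom.comp_apply, ← IsScalarTower.algebraMap_apply κ (RatFunc κ) E, hσ,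
        RingHom.coe_coe, galois_algebraMap]
    · change σ (g (tvar κ E)) = g (σ (tvar κ E))
      rw [hσt, galois_tvar, hσt]
  have := splittingField_ringHom_ext f (ι := σ.comp (g : E →+* E)) (ι' := (g : E →+* E).comp σ)
    (fun r => congrArg (fun f => f r) hk) fun y hy => by
      have hgy : g y ∈ f.rootSet E := by
        rw [mem_rootSet] at hy ⊢
        refine ⟨hy.1, ?_⟩
        have := congrArg g hy.2
        rwa [map_zero, ← AlgEquiv.coe_toAlgHom, ← aeval_algHom_apply] at this
      simp only [RingHom.comp_apply, RingHom.coe_coe]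
      rw [hroot _ hgy, hroot _ hy]
  exact congrArg (fun f => f y) this

/-- If a good specialisation has a rational root, its Frobenius element fixes a root. -/
lemma IsExpansion.exists_fixed_root [IsAlgClosed κ] {u v : κ[X]}
    [IsSplittingField (RatFunc κ) E (pencil u v)] {D : ℕ} (hu : u.natDegree ≤ D)
    (hv : v.natDegree ≤ D) {t₀ : κ} (hgood : RatIterate.IsGoodAt u v D t₀)
    {ι : E →+* LaurentSeries κ} (hι : IsExpansion t₀ ι) (f : κ →+* κ) (σ : E →+* E)
    (hσ : ∀ y ∈ (pencil u v).rootSet E, σ y = y) {g : Gal(E/RatFunc κ)}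
    (hg : ∀ y, ι (g (σ y)) = laurentMap f (ι y)) {x : κ} (hx : (u - C t₀ * v).eval x = 0)
    (hfx : f x = x) : ∃ y ∈ (pencil u v).rootSet E, g y = y := by
  obtain ⟨s, hs, hall, -, hsep⟩ := exists_roots_pencil hu hv hgood
  have h0 : pencil u v ≠ 0 := hsep.ne_zero
  have hmap : ((pencil u v).map (algebraMap (RatFunc κ) E)).map ι =
      (pencil u v).map (expandAt t₀) := by
    rw [Polynomial.map_map, hι.comp_eq]
  have hrootι : ∀ y ∈ (pencil u v).rootSet E, ((pencil u v).map (expandAt t₀)).IsRoot (ι y) := by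
    intro y hy
    rw [← hmap, IsRoot, eval_map, eval₂_at_apply, eval_map_algebraMap, (mem_rootSet.1 hy).2,
      map_zero]
  obtain ⟨y, hy, hyx⟩ : ∃ y ∈ (pencil u v).rootSet E,
      ι y = algebraMap (PowerSeries κ) (LaurentSeries κ) (s x) := by
    have h1 := (hs x hx).2
    rw [← mem_roots ((Polynomial.map_ne_zero_iff (expandAt t₀).injective).2 h0), ← hmap,
      (IsSplittingField.splits E (pencil u v)).roots_map, Multiset.mem_map] at h1
    obtain ⟨y, hy, hyx⟩ := h1
    refine ⟨y, ?_, hyx⟩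
    rw [mem_rootSet]
    refine ⟨h0, ?_⟩
    rw [← eval_map_algebraMap]
    exact isRoot_of_mem_roots hy
  refine ⟨y, hy, ι.injective ?_⟩
  have hgy : g y ∈ (pencil u v).rootSet E := by
    rw [mem_rootSet]
    refine ⟨h0, ?_⟩
    have := congrArg g (mem_rootSet.1 hy).2
    rwa [map_zero, ← AlgEquiv.coe_toAlgHom, ← aeval_algHom_apply] at this
  obtain ⟨x', hx', hyx'⟩ := hall _ (hrootι _ hgy)
  have h2 := hg y
  rw [hσ y hy, hyx', hyx, laurentMap_algebraMap] at h2
  have h3 := congrArg PowerSeries.constantCoeff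
    (IsFractionRing.injective (PowerSeries κ) (LaurentSeries κ) h2)
  rw [(hs x' hx').1, ← PowerSeries.coeff_zero_eq_constantCoeff_apply, PowerSeries.coeff_map,
    PowerSeries.coeff_zero_eq_constantCoeff_apply, (hs x hx).1, hfx] at h3
  rw [hyx', hyx, h3]

variable [IsGalois (RatFunc κ) E]

/-- The Frobenius element attached to an expansion at a rational point. -/
lemma IsExpansion.exists_frobenius {t₀ : κ} {ι : E →+* LaurentSeries κ} (hι : IsExpansion t₀ ι)
    (f : κ ≃+* κ) (hf : f t₀ = t₀) (σ : E ≃+* E)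
    (hσ : ∀ x, σ (algebraMap κ E x) = algebraMap κ E (f x)) (hσt : σ (tvar κ E) = tvar κ E) :
    ∃ g : Gal(E/RatFunc κ), ∀ y, ι (g (σ y)) = laurentMap f (ι y) := by
  set ι' : E →+* LaurentSeries κ :=
    ((laurentMap (f : κ →+* κ)).comp ι).comp (σ.symm : E →+* E) with hι'
  have h' : IsExpansion t₀ ι' := by
    refine ⟨fun x => ?_, ?_⟩
    · have : σ.symm (algebraMap κ E x) = algebraMap κ E (f.symm x) := by
        rw [RingEquiv.symm_apply_eq, hσ, RingEquiv.apply_symm_apply]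
      rw [hι', RingHom.comp_apply, RingHom.comp_apply, RingEquiv.coe_toRingHom, this,
        hι.map_const, laurentMap_algebraMap, PowerSeries.map_C, RingEquiv.coe_toRingHom,
        RingEquiv.apply_symm_apply]
    · have : σ.symm (tvar κ E) = tvar κ E := by rw [RingEquiv.symm_apply_eq, hσt]
      rw [hι', RingHom.comp_apply, RingHom.comp_apply, RingEquiv.coe_toRingHom, this,
        hι.map_tvar, laurentMap_algebraMap, map_add, PowerSeries.map_C, PowerSeries.map_X,
        RingEquiv.coe_toRingHom, hf]
  obtain ⟨g, hg⟩ := exists_galois_of_comp_eq (h'.comp_eq.trans hι.comp_eq.symm)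
  refine ⟨g, fun y => ?_⟩
  rw [← hg]
  simp [hι']

variable [FiniteDimensional (RatFunc κ) E]

variable (E) in
/-- The number of points with a rational preimage is controlled by the proportion of elements
of the Galois group having a fixed point. -/
lemma exists_card_mul_card_le [IsAlgClosed κ] {u v : κ[X]}
    [IsSplittingField (RatFunc κ) E (pencil u v)] {D : ℕ} (hu : u.natDegree ≤ D)
    (hv : v.natDegree ≤ D) (p : ℕ) [ExpChar κ p] :
    ∃ C₁ A₀ : ℕ, ∀ a b : ℕ, A₀ < p ^ a → p ^ b ≤ p ^ a → ∀ σ : E ≃+* E,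
      (∀ x, σ (algebraMap κ E x) = algebraMap κ E (x ^ p ^ (a + b))) →
      σ (tvar κ E) = tvar κ E → (∀ y ∈ (pencil u v).rootSet E, σ y = y) →
      ∀ S : Finset κ, (∀ t₀ ∈ S, RatIterate.IsGoodAt u v D t₀ ∧ t₀ ^ p ^ (a + b) = t₀ ∧
        ∃ x, x ^ p ^ (a + b) = x ∧ (u - C t₀ * v).eval x = 0) →
      S.card * Nat.card Gal(E/RatFunc κ) ≤
        Nat.card {g : Gal(E/RatFunc κ) // ∃ y ∈ (pencil u v).rootSet E, g y = y} *
          (p ^ (a + b) + C₁ * p ^ a) := by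
  classical
  obtain ⟨C₁, A₀, hmain⟩ := exists_card_frobenius_le κ E p
  refine ⟨C₁, A₀, fun a b ha hb σ hσ hσt hσr S hS => ?_⟩
  obtain rfl | ⟨t₁, ht₁⟩ := S.eq_empty_or_nonempty
  · simp
  let fr : κ ≃+* κ := iterateFrobeniusEquiv κ p (a + b)
  have hfr : ∀ x, fr x = x ^ p ^ (a + b) := fun x => rfl
  have hexι : ∀ t₀, ∃ ι : E →+* LaurentSeries κ, t₀ ∈ S → IsExpansion t₀ ι := by
    intro t₀
    by_cases ht : t₀ ∈ S
    · obtain ⟨s, -, -, hsplit, -⟩ := exists_roots_pencil hu hv (hS t₀ ht).1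
      obtain ⟨ι, hι⟩ := exists_ringHom_of_splits (E := E) (pencil u v) (expandAt t₀) hsplit
      exact ⟨ι, fun _ => isExpansion_of_comp_eq hι⟩
    · obtain ⟨s, -, -, hsplit, -⟩ := exists_roots_pencil hu hv (hS t₁ ht₁).1
      obtain ⟨ι, hι⟩ := exists_ringHom_of_splits (E := E) (pencil u v) (expandAt t₁) hsplit
      exact ⟨ι, fun h => absurd h ht⟩
  choose ι hι using hexι
  have hexg : ∀ t₀, ∃ g : Gal(E/RatFunc κ), t₀ ∈ S →
      ∀ y, ι t₀ (g (σ y)) = laurentMap fr (ι t₀ y) := by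
    intro t₀
    by_cases ht : t₀ ∈ S
    · obtain ⟨g, hg⟩ := (hι t₀ ht).exists_frobenius fr (hS t₀ ht).2.1 σ hσ hσt
      exact ⟨g, fun _ => hg⟩
    · exact ⟨1, fun h => absurd h ht⟩
  choose g₀ hg₀ using hexg
  let Fix : Finset Gal(E/RatFunc κ) :=
    Finset.univ.filter fun g => ∃ y ∈ (pencil u v).rootSet E, g y = y
  have hFix : Nat.card {g : Gal(E/RatFunc κ) // ∃ y ∈ (pencil u v).rootSet E, g y = y} =
      Fix.card := by
    rw [Nat.card_eq_fintype_card, Fintype.card_subtype]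
  have hmapsto : ∀ x ∈ S ×ˢ (Finset.univ : Finset Gal(E/RatFunc κ)),
      x.2⁻¹ * g₀ x.1 * x.2 ∈ Fix := by
    rintro ⟨t₀, h⟩ hx
    have ht : t₀ ∈ S := (Finset.mem_product.1 hx).1
    obtain ⟨hgood, -, x, hxQ, hx0⟩ := hS t₀ ht
    obtain ⟨y, hy, hgy⟩ := (hι t₀ ht).exists_fixed_root hu hv hgood (fr : κ →+* κ) (σ : E →+* E)
      hσr (hg₀ t₀ ht) hx0 hxQ
    refine Finset.mem_filter.2 ⟨Finset.mem_univ _, h⁻¹ y, ?_, ?_⟩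
    · rw [mem_rootSet] at hy ⊢
      refine ⟨hy.1, ?_⟩
      have := congrArg (h⁻¹ : Gal(E/RatFunc κ)) hy.2
      rwa [map_zero, ← AlgEquiv.coe_toAlgHom, ← aeval_algHom_apply] at this
    · simp only [AlgEquiv.mul_apply]
      rw [← AlgEquiv.mul_apply h, mul_inv_cancel, AlgEquiv.one_apply, hgy]
  have hfib : ∀ g ∈ Fix, ((S ×ˢ (Finset.univ : Finset Gal(E/RatFunc κ))).filter
      fun x => x.2⁻¹ * g₀ x.1 * x.2 = g).card ≤ p ^ (a + b) + C₁ * p ^ a := by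
    intro g hg
    rcases Finset.eq_empty_or_nonempty ((S ×ˢ (Finset.univ : Finset Gal(E/RatFunc κ))).filter
      fun x => x.2⁻¹ * g₀ x.1 * x.2 = g) with hemp | ⟨⟨t₁, h₁⟩, hx₁⟩
    · rw [hemp]; simp
    have ht₁ : t₁ ∈ S := (Finset.mem_product.1 (Finset.mem_filter.1 hx₁).1).1
    refine hmain (hι t₁ ht₁) ι a b ha hb (σ.trans (g : E ≃+* E)) ?_ ?_ _ ?_
    · change g (σ (tvar κ E)) = _
      rw [hσt, galois_tvar]
    · intro x
      change g (σ _) = _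
      rw [hσ, galois_algebraMap]
    · rintro ⟨t₀, h⟩ hx
      obtain ⟨hx, hgx⟩ := Finset.mem_filter.1 hx
      have ht : t₀ ∈ S := (Finset.mem_product.1 hx).1
      refine ⟨hι t₀ ht, fun y hy => ?_⟩
      obtain ⟨s, hs⟩ := (hι t₀ ht).exists_powerSeries (galois_integralOver h hy)
      have hcomm := semilinear_comm_galois (f := pencil u v) _ (σ : E →+* E) hσ hσt hσr h y
      have e1 : h ((σ.trans (g : E ≃+* E)) y) = g₀ t₀ (σ (h y)) := by
        rw [RingEquiv.coe_toRingHom] at hcomm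
        rw [hcomm]
        change h (g (σ y)) = _
        rw [← hgx]
        simp only [← AlgEquiv.mul_apply]
        congr 1
        group
      simp only at hs ⊢
      rw [e1, hg₀ t₀ ht, hs, laurentMap_algebraMap, coeff_zero_algebraMap, coeff_zero_algebraMap,
        ← PowerSeries.coeff_zero_eq_constantCoeff_apply, PowerSeries.coeff_map,
        PowerSeries.coeff_zero_eq_constantCoeff_apply]
      exact hfr _
  rw [hFix, Nat.card_eq_fintype_card, ← Finset.card_univ, ← Finset.card_product,
    Finset.card_eq_sum_card_fiberwise hmapsto, ← smul_eq_mul (a := Fix.card)]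
  exact Finset.sum_le_card_nsmul _ _ _ hfib


section Descent

variable {k E : Type*} [Field k] [Field E] [Algebra k E]

/-- Galois descent inside a finite normal subextension `L` of `E`, for a subgroup of `Aut(E/k)`
whose fixed field is `k`. -/
lemma mem_of_forall_fixing (S : Subgroup Gal(E/k))
    (hS : ∀ y : E, (∀ s ∈ S, s y = y) → y ∈ (algebraMap k E).range)
    (L : IntermediateField k E) [FiniteDimensional k L] [Normal k L] (M : IntermediateField k L)
    {y : L} (hy : ∀ s ∈ S, (∀ z ∈ M, s (z : E) = z) → s (y : E) = y) : y ∈ M := by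
  set H : Subgroup Gal(L/k) := S.map (AlgEquiv.restrictNormalHom L) with hH
  have hres : ∀ (s : Gal(E/k)) (z : L), ((AlgEquiv.restrictNormalHom L s z : L) : E) = s z :=
    fun s z => AlgEquiv.restrictNormal_commutes s L z
  have hfix : IntermediateField.fixedField H = ⊥ := by
    rw [eq_bot_iff]
    intro z hz
    rw [IntermediateField.mem_fixedField_iff] at hz
    obtain ⟨r, hr⟩ := hS z fun s hs => by
      rw [← hres, hz _ (Subgroup.mem_map_of_mem _ hs)]
    exact IntermediateField.mem_bot.2 ⟨r, Subtype.ext hr⟩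
  have : IsGalois k L := IsGalois.of_fixedField_eq_bot k L <| by
    rw [eq_bot_iff, ← hfix]
    exact IntermediateField.fixedField_antitone le_top
  have htop : H = ⊤ := by
    rw [← IntermediateField.fixingSubgroup_fixedField H, hfix,
      IntermediateField.fixingSubgroup_bot]
  rw [← IsGalois.fixedField_fixingSubgroup M, IntermediateField.mem_fixedField_iff]
  intro h hh
  have hmem : h ∈ H := htop ▸ Subgroup.mem_top h
  obtain ⟨s, hs, rfl⟩ := hmem
  refine Subtype.ext ?_
  rw [hres]
  refine hy s hs fun z hz => ?_
  rw [← hres, (IntermediateField.mem_fixingSubgroup_iff _ _).1 hh z hz]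

variable {κ : Type*} [Field κ]

/-- The automorphisms acting on the constants as an integral power of `fr`. -/
def powerSubgroup (i : κ →+* E) (fr : κ ≃+* κ) : Subgroup Gal(E/k) where
  carrier := {s | ∃ j : ℤ, ∀ x, s (i x) = i ((fr ^ j) x)}
  one_mem' := ⟨0, fun x => by simp⟩
  mul_mem' := by
    rintro s s' ⟨j, hj⟩ ⟨j', hj'⟩
    exact ⟨j + j', fun x => by rw [AlgEquiv.mul_apply, hj', hj, zpow_add, RingAut.mul_apply]⟩
  inv_mem' := by
    rintro s ⟨j, hj⟩
    refine ⟨-j, fun x => ?_⟩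
    change s.symm _ = _
    rw [AlgEquiv.symm_apply_eq, hj, ← RingAut.mul_apply, ← zpow_add, add_neg_cancel, zpow_zero,
      RingAut.one_apply]

/-- The exponents of the powers of `fr` that extend to an automorphism of `E` fixing the set `R`. -/
def exponentSubgroup (k : Type*) [Field k] [Algebra k E] (i : κ →+* E) (fr : κ ≃+* κ) (R : Set E) :
    AddSubgroup ℤ where
  carrier := {j | ∃ s : Gal(E/k), (∀ x, s (i x) = i ((fr ^ j) x)) ∧ ∀ y ∈ R, s y = y}
  zero_mem' := ⟨1, fun x => by simp, fun y _ => rfl⟩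
  add_mem' := by
    rintro j j' ⟨s, hs, hR⟩ ⟨s', hs', hR'⟩
    exact ⟨s * s', fun x => by rw [AlgEquiv.mul_apply, hs', hs, zpow_add, RingAut.mul_apply],
      fun y hy => by rw [AlgEquiv.mul_apply, hR' y hy, hR y hy]⟩
  neg_mem' := by
    rintro j ⟨s, hs, hR⟩
    refine ⟨s⁻¹, fun x => ?_, fun y hy => ?_⟩
    · change s.symm _ = _
      rw [AlgEquiv.symm_apply_eq, hs, ← RingAut.mul_apply, ← zpow_add, add_neg_cancel, zpow_zero,
        RingAut.one_apply]
    · change s.symm _ = _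
      rw [AlgEquiv.symm_apply_eq, hR y hy]

lemma exponentSubgroup_ne_bot (i : κ →+* E) (fr : κ ≃+* κ) (f : k[X]) (σ : Gal(E/k))
    (hσ : ∀ x, σ (i x) = i (fr x)) : exponentSubgroup k i fr (f.rootSet E) ≠ ⊥ := by
  have hpow : ∀ n : ℕ, ∀ x, (σ ^ n) (i x) = i ((fr ^ n) x) := by
    intro n
    induction n with
    | zero => intro x; simp
    | succ n ih => intro x; rw [pow_succ', AlgEquiv.mul_apply, ih, hσ, pow_succ', RingAut.mul_apply]
  have hmem : ∀ (s : Gal(E/k)) (y), y ∈ f.rootSet E → s y ∈ f.rootSet E := by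
    intro s y hy
    rw [mem_rootSet] at hy ⊢
    refine ⟨hy.1, ?_⟩
    have := congrArg s hy.2
    rwa [map_zero, ← AlgEquiv.coe_toAlgHom, ← aeval_algHom_apply] at this
  obtain ⟨a, b, hab, he⟩ := Finite.exists_ne_map_eq_of_infinite
    fun (n : ℕ) (y : f.rootSet E) => (⟨(σ ^ n) y, hmem _ _ y.2⟩ : f.rootSet E)
  have key : ∀ a b : ℕ, a < b → (∀ y ∈ f.rootSet E, (σ ^ a) y = (σ ^ b) y) →
      exponentSubgroup k i fr (f.rootSet E) ≠ ⊥ := by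
    intro a b hab he h
    have : ((b - a : ℕ) : ℤ) ∈ exponentSubgroup k i fr (f.rootSet E) := by
      refine ⟨σ ^ (b - a), fun x => by rw [hpow, zpow_natCast], fun y hy => ?_⟩
      apply (σ ^ a).injective
      rw [← AlgEquiv.mul_apply, ← pow_add, Nat.add_sub_cancel' hab.le, he y hy]
    rw [h, AddSubgroup.mem_bot] at this
    omega
  have he' : ∀ y ∈ f.rootSet E, (σ ^ a) y = (σ ^ b) y := fun y hy =>
    congrArg Subtype.val (congrFun he ⟨y, hy⟩)
  rcases lt_or_gt_of_ne hab with h | h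
  · exact key a b h he'
  · exact key b a h fun y hy => (he' y hy).symm

/-- A polynomial `X ^ Q - X` splits in any extension of an algebraically closed field. -/
lemma splits_X_pow_sub_X [IsAlgClosed κ] (i : κ →+* E) (Q : ℕ) :
    (((X : k[X]) ^ Q - X).map (algebraMap k E)).Splits := by
  have : ((X : k[X]) ^ Q - X).map (algebraMap k E) = ((X : κ[X]) ^ Q - X).map i := by simp
  rw [this]
  exact (IsAlgClosed.splits _).map i

lemma exists_eq_of_pow_eq [IsAlgClosed κ] (i : κ →+* E) {Q : ℕ} (hQ : 1 < Q) {y : E}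
    (hy : y ^ Q = y) : ∃ x, i x = y ∧ x ^ Q = x := by
  have h0 : ((X : κ[X]) ^ Q - X) ≠ 0 := FiniteField.X_pow_card_sub_X_ne_zero κ hQ
  have hmem : y ∈ (((X : κ[X]) ^ Q - X).map i).roots := by
    rw [mem_roots ((Polynomial.map_ne_zero_iff i.injective).2 h0)]
    simp [hy]
  rw [(IsAlgClosed.splits ((X : κ[X]) ^ Q - X)).roots_map, Multiset.mem_map] at hmem
  obtain ⟨x, hx, rfl⟩ := hmem
  refine ⟨x, rfl, ?_⟩
  simpa [sub_eq_zero] using (mem_roots h0).1 hx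

/-- Some positive power of Frobenius extends to an automorphism fixing the roots of `f`, with
exponent bounded by the degree of the constant field of a splitting field of `f`. -/
lemma exists_automorphism_fixing_roots {p q : ℕ} [CharP k p] (hpq : p ∣ q) (hq1 : 1 < q)
    [IsAlgClosed κ] (i : κ →+* E) (fr : κ ≃+* κ) (hfr : ∀ x, fr x = x ^ q) {f : k[X]}
    (hf : (f.map (algebraMap k E)).Splits) (hf0 : f ≠ 0) (σ : Gal(E/k))
    (hσ : ∀ x, σ (i x) = i (fr x))
    (hfix : ∀ y : E, (∀ s : Gal(E/k), (∀ x, s (i x) = i x) → s y = y) → σ y = y →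
      y ∈ (algebraMap k E).range)
    (E₀ : Type*) [Field E₀] [Algebra k E₀] [IsSplittingField k E₀ f] :
    ∃ c : ℕ, 0 < c ∧ (∃ s : Gal(E/k), (∀ x, s (i x) = i (x ^ q ^ c)) ∧
      ∀ y ∈ f.rootSet E, s y = y) ∧ q ^ c ≤ {x : E₀ | x ^ q ^ c = x}.ncard := by
  have hfrpow : ∀ n : ℕ, ∀ x, (fr ^ n) x = x ^ q ^ n := by
    intro n
    induction n with
    | zero => intro x; simp
    | succ n ih => intro x; rw [pow_succ', RingAut.mul_apply, ih, hfr, ← pow_mul, pow_succ]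
  obtain ⟨z, hz⟩ := Int.subgroup_cyclic (exponentSubgroup k i fr (f.rootSet E))
  rw [← AddSubgroup.zmultiples_eq_closure] at hz
  have hz0 : z ≠ 0 := by
    rintro rfl
    exact exponentSubgroup_ne_bot i fr f σ hσ (by rw [hz, AddSubgroup.zmultiples_zero_eq_bot])
  set c := z.natAbs with hc
  have hc0 : 0 < c := Int.natAbs_pos.2 hz0
  have hmemc : (c : ℤ) ∈ exponentSubgroup k i fr (f.rootSet E) := by
    rw [hz, Int.mem_zmultiples_iff]
    exact Int.dvd_natAbs_self
  obtain ⟨s, hs, hsr⟩ := hmemc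
  refine ⟨c, hc0, ⟨s, fun x => by rw [hs, zpow_natCast, hfrpow], hsr⟩, ?_⟩
  have hQ : 1 < q ^ c := Nat.one_lt_pow hc0.ne' hq1
  set g : k[X] := X ^ q ^ c - X with hg
  have hg0 : g ≠ 0 := FiniteField.X_pow_card_sub_X_ne_zero k hQ
  have hgE : (g.map (algebraMap k E)).Splits := splits_X_pow_sub_X i _
  have hPE : ((f * g).map (algebraMap k E)).Splits := by
    rw [Polynomial.map_mul]
    exact hf.mul hgE
  set L : IntermediateField k E := IntermediateField.adjoin k ((f * g).rootSet E) with hL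
  have hLs : IsSplittingField k L (f * g) := IntermediateField.adjoin_rootSet_isSplittingField hPE
  have : FiniteDimensional k L := IsSplittingField.finiteDimensional L (f * g)
  have : Normal k L := Normal.of_isSplittingField (f * g)
  have hPL := IsSplittingField.splits L (f * g)
  have hfg0 : (f * g).map (algebraMap k L) ≠ 0 :=
    (Polynomial.map_ne_zero_iff (algebraMap k L).injective).2 (mul_ne_zero hf0 hg0)
  have hfL : (f.map (algebraMap k L)).Splits :=
    hPL.of_dvd hfg0 (Polynomial.map_dvd _ (dvd_mul_right f g))
  have hgL : (g.map (algebraMap k L)).Splits :=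
    hPL.of_dvd hfg0 (Polynomial.map_dvd _ (dvd_mul_left g f))
  let j : E₀ →ₐ[k] L := IsSplittingField.lift E₀ f hfL
  have hjroot : ∀ y ∈ f.rootSet E, ∃ w : E₀, ((j w : L) : E) = y := by
    intro y hy
    rw [← hfL.image_rootSet L.val, ← (IsSplittingField.splits E₀ f).image_rootSet j] at hy
    obtain ⟨_, ⟨w, hw, rfl⟩, rfl⟩ := hy
    exact ⟨w, rfl⟩
  have hgroot : ∀ α : L, α ^ q ^ c = α → ∃ w : E₀, j w = α := by
    intro α hα
    refine mem_of_forall_fixing (powerSubgroup i fr) ?_ L j.fieldRange (y := α) ?_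
    · intro y hy
      refine hfix y (fun s hs => hy s ⟨0, fun x => by simpa using hs x⟩) (hy σ ⟨1, fun x => ?_⟩)
      simpa using hσ x
    · rintro s ⟨e, he⟩ hs
      have hemem : e ∈ exponentSubgroup k i fr (f.rootSet E) := by
        refine ⟨s, he, fun y hy => ?_⟩
        obtain ⟨w, rfl⟩ := hjroot y hy
        exact hs _ ⟨w, rfl⟩
      rw [hz, Int.mem_zmultiples_iff, ← Int.natAbs_dvd, ← hc] at hemem
      obtain ⟨r, rfl⟩ := hemem
      obtain ⟨x, hx, hxQ⟩ := exists_eq_of_pow_eq i hQ (y := (α : E)) (congrArg Subtype.val hα)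
      rw [← hx, he]
      congr 1
      have h1 : fr ^ c ∈ MulAction.stabilizer (RingAut κ) x := by
        change (fr ^ c) x = x
        rw [hfrpow, hxQ]
      rw [zpow_mul, zpow_natCast]
      exact Subgroup.zpow_mem _ h1 r
  have hcard : Fintype.card (g.rootSet L) = q ^ c := by
    rw [card_rootSet_eq_natDegree (galois_poly_separable p _ (hpq.trans (dvd_pow_self q hc0.ne')))
      hgL, FiniteField.X_pow_card_sub_X_natDegree_eq k hQ]
  have hfin : {x : E₀ | x ^ q ^ c = x}.Finite := by
    have := (((X : E₀[X]) ^ q ^ c - X).rootSet_finite E₀)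
    refine this.subset fun x hx => ?_
    rw [mem_rootSet_of_ne (FiniteField.X_pow_card_sub_X_ne_zero E₀ hQ)]
    simpa [sub_eq_zero] using hx
  rw [← Nat.card_eq_fintype_card, Nat.card_coe_set_eq] at hcard
  refine hcard.symm.le.trans <| (Set.ncard_le_ncard ?_ (hfin.image j)).trans (Set.ncard_image_le hfin)
  intro α hα
  rw [mem_rootSet_of_ne hg0] at hα
  have hα' : α ^ q ^ c = α := by simpa [hg, sub_eq_zero] using hα
  obtain ⟨w, rfl⟩ := hgroot α hα'
  exact ⟨w, j.injective ((map_pow j w _).trans hα'), rfl⟩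

end Descent


section RatMap

variable {F κ : Type*} [Field F] [Field κ]

/-- The action of a field homomorphism on the coefficients of rational functions. -/
noncomputable def ratMap (h : F →+* κ) : RatFunc F →+* RatFunc κ :=
  RatFunc.mapRingHom (Polynomial.mapRingHom h)
    (nonZeroDivisors_le_comap_nonZeroDivisors_of_injective _ (Polynomial.map_injective h h.injective))

lemma ratMap_algebraMap (h : F →+* κ) (w : F[X]) :
    ratMap h (algebraMap F[X] (RatFunc F) w) = algebraMap κ[X] (RatFunc κ) (w.map h) := by
  have := RatFunc.map_apply_div_ne_zero (Polynomial.mapRingHom h)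
    (nonZeroDivisors_le_comap_nonZeroDivisors_of_injective _ (Polynomial.map_injective h h.injective))
     w 1 one_ne_zero
  simp only [map_one, div_one] at this
  exact this

lemma ratMap_C (h : F →+* κ) (x : F) : ratMap h (RatFunc.C x) = RatFunc.C (h x) := by
  rw [← RatFunc.algebraMap_C, ratMap_algebraMap, Polynomial.map_C, RatFunc.algebraMap_C]

lemma ratMap_X (h : F →+* κ) : ratMap h RatFunc.X = RatFunc.X := by
  rw [← RatFunc.algebraMap_X, ratMap_algebraMap, Polynomial.map_X, RatFunc.algebraMap_X]

/-- A rational function fixed by `fr` on coefficients is defined over the field fixed by `fr`. -/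
lemma exists_ratMap_eq (h : F →+* κ) (fr : κ →+* κ) (hfr : ∀ x, fr x = x → x ∈ h.range)
    {r : RatFunc κ} (hr : ratMap fr r = r) : ∃ s, ratMap h s = r := by
  have hpoly : ∀ w : κ[X], w.map fr = w → ∃ w₀ : F[X], w₀.map h = w := by
    intro w hw
    have : w ∈ Polynomial.lifts h := by
      rw [Polynomial.lifts_iff_coeff_lifts]
      intro n
      obtain ⟨a, ha⟩ := hfr (w.coeff n) (by rw [← coeff_map, hw])
      exact ⟨a, ha⟩
    exact this
  have hinj := RatFunc.algebraMap_injective κ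
  have hd0 : algebraMap κ[X] (RatFunc κ) r.denom ≠ 0 := RatFunc.algebraMap_ne_zero r.denom_ne_zero
  have hd1 : algebraMap κ[X] (RatFunc κ) (r.denom.map fr) ≠ 0 :=
    RatFunc.algebraMap_ne_zero ((Polynomial.map_ne_zero_iff fr.injective).2 r.denom_ne_zero)
  have h1 : algebraMap κ[X] (RatFunc κ) (r.num.map fr) /
      algebraMap κ[X] (RatFunc κ) (r.denom.map fr) =
        algebraMap κ[X] (RatFunc κ) r.num / algebraMap κ[X] (RatFunc κ) r.denom := by
    rw [← ratMap_algebraMap, ← ratMap_algebraMap, ← map_div₀, RatFunc.num_div_denom, hr]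
  rw [div_eq_div_iff hd1 hd0, ← map_mul, ← map_mul] at h1
  have h2 := hinj h1
  have hdvd : r.denom ∣ r.denom.map fr :=
    (RatFunc.isCoprime_num_denom r).symm.dvd_of_dvd_mul_left ⟨r.num.map fr, by rw [← h2, mul_comm]⟩
  have hd : r.denom.map fr = r.denom :=
    (eq_of_monic_of_dvd_of_natDegree_le (RatFunc.monic_denom r) ((RatFunc.monic_denom r).map fr)
      hdvd (natDegree_map_le))
  rw [hd] at h2
  obtain ⟨a, ha⟩ := hpoly _ (mul_right_cancel₀ r.denom_ne_zero h2)
  obtain ⟨b, hb⟩ := hpoly _ hd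
  refine ⟨algebraMap F[X] (RatFunc F) a / algebraMap F[X] (RatFunc F) b, ?_⟩
  rw [map_div₀, ratMap_algebraMap, ratMap_algebraMap, ha, hb, RatFunc.num_div_denom]

end RatMap

/-- A semilinear extension of `τ` to the splitting field of a polynomial invariant under `τ`. -/
lemma exists_semilinear_lift {k E : Type*} [Field k] [Field E] [Algebra k E] (f : k[X])
    [IsSplittingField k E f] (τ : k ≃+* k) (hf : f.map (τ : k →+* k) = f) :
    ∃ σ : E ≃+* E, ∀ r, σ (algebraMap k E r) = algebraMap k E (τ r) := by
  have : FiniteDimensional k E := IsSplittingField.finiteDimensional E f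
  have key : ∀ τ : k ≃+* k, f.map (τ : k →+* k) = f →
      ∃ ι : E →+* E, ι.comp (algebraMap k E) = (algebraMap k E).comp (τ : k →+* k) := by
    intro τ hf
    refine exists_ringHom_of_splits f ((algebraMap k E).comp (τ : k →+* k)) ?_
    rw [← Polynomial.map_map, hf]
    exact IsSplittingField.splits E f
  obtain ⟨ι, hι⟩ := key τ hf
  obtain ⟨ι', hι'⟩ := key τ.symm <| by
    conv_lhs => rw [← hf]
    rw [Polynomial.map_map, RingEquiv.symm_comp, Polynomial.map_id]
  have h1 : ∀ r, ι (algebraMap k E r) = algebraMap k E (τ r) := fun r => congrArg (fun g => g r) hι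
  have h2 : ∀ r, ι' (algebraMap k E r) = algebraMap k E (τ.symm r) :=
    fun r => congrArg (fun g => g r) hι'
  let φ : E →ₐ[k] E := 
    { ι.comp ι' with
      commutes' := fun r => by
        change ι (ι' _) = _
        rw [h2, h1, RingEquiv.apply_symm_apply] }
  have hsurj : Function.Surjective ι := fun y => by
    obtain ⟨x, hx⟩ := (Algebra.IsAlgebraic.algHom_bijective φ).2 y
    exact ⟨ι' x, hx⟩
  exact ⟨RingEquiv.ofBijective ι ⟨ι.injective, hsurj⟩, h1⟩

lemma mem_range_algebraMap_of_pow_card_eq {F L : Type*} [Field F] [Fintype F] [Field L]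
    [Algebra F L] {x : L} (hx : x ^ Fintype.card F = x) : x ∈ (algebraMap F L).range := by
  have h0 : (X ^ Fintype.card F - X : F[X]) ≠ 0 :=
    FiniteField.X_pow_card_sub_X_ne_zero F Fintype.one_lt_card
  have hsplit : (X ^ Fintype.card F - X : F[X]).Splits := by
    rw [splits_iff_card_roots, FiniteField.roots_X_pow_card_sub_X,
      FiniteField.X_pow_card_sub_X_natDegree_eq F Fintype.one_lt_card]
    rfl
  have hmem : x ∈ ((X ^ Fintype.card F - X : F[X]).map (algebraMap F L)).roots := by
    rw [mem_roots ((Polynomial.map_ne_zero_iff (algebraMap F L).injective).2 h0)]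
    simp [hx]
  rw [hsplit.roots_map, Multiset.mem_map] at hmem
  obtain ⟨a, -, rfl⟩ := hmem
  exact ⟨a, rfl⟩

/-- Some power of Frobenius on the constants extends to an automorphism of the geometric splitting
field that fixes `t` and all the roots, the exponent being bounded by the constant field degree of
the arithmetic splitting field. -/
lemma exists_power_frobenius_fixing_roots {F : Type*} [Field F] [Fintype F]
    {f₀ : (RatFunc F)[X]} {f : (RatFunc (AlgebraicClosure F))[X]}
    (hf : f₀.map (ratMap (algebraMap F (AlgebraicClosure F))) = f) (hsep : f.Separable)
    (E : Type*) [Field E] [Algebra (RatFunc (AlgebraicClosure F)) E] [Algebra (AlgebraicClosure F) E]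
    [IsScalarTower (AlgebraicClosure F) (RatFunc (AlgebraicClosure F)) E]
    [IsSplittingField (RatFunc (AlgebraicClosure F)) E f]
    (E₀ : Type*) [Field E₀] [Algebra (RatFunc F) E₀] [IsSplittingField (RatFunc F) E₀ f₀] :
    ∃ c : ℕ, 0 < c ∧ (∃ σ : E ≃+* E,
      (∀ x, σ (algebraMap (AlgebraicClosure F) E x) =
        algebraMap (AlgebraicClosure F) E (x ^ Fintype.card F ^ c)) ∧
      σ (tvar (AlgebraicClosure F) E) = tvar (AlgebraicClosure F) E ∧ ∀ y ∈ f.rootSet E, σ y = y) ∧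
      Fintype.card F ^ c ≤ {x : E₀ | x ^ Fintype.card F ^ c = x}.ncard := by
  set h := algebraMap F (AlgebraicClosure F) with hh
  let fr : AlgebraicClosure F ≃+* AlgebraicClosure F :=
    (FiniteField.frobeniusAlgEquivOfAlgebraic F (AlgebraicClosure F) : _ ≃+* _)
  have hfr : ∀ x, fr x = x ^ Fintype.card F := fun x => rfl
  have hfrh : ∀ x, (fr : AlgebraicClosure F →+* AlgebraicClosure F) (h x) = h x :=
    fun x => (FiniteField.frobeniusAlgEquivOfAlgebraic F (AlgebraicClosure F)).commutes x
  have hratcomp : ∀ a b : AlgebraicClosure F →+* AlgebraicClosure F, ∀ r,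
      ratMap a (ratMap b r) = ratMap (a.comp b) r := by
    intro a b r
    have : (ratMap a).comp (ratMap b) = ratMap (a.comp b) := by
      refine ratFunc_ringHom_ext (fun x => ?_) ?_
      · simp only [RatFunc.algebraMap_eq_C, RingHom.comp_apply, ratMap_C]
      · simp only [RingHom.comp_apply, ratMap_X]
    exact congrArg (fun g => g r) this
  have hratid : ∀ r, ratMap (RingHom.id (AlgebraicClosure F)) r = r := by
    intro r
    have : ratMap (RingHom.id (AlgebraicClosure F)) = RingHom.id _ := by
      refine ratFunc_ringHom_ext (fun x => ?_) ?_
      · simp only [RatFunc.algebraMap_eq_C, RingHom.id_apply, ratMap_C]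
      · simp only [RingHom.id_apply, ratMap_X]
    exact congrArg (fun g => g r) this
  let τ : RatFunc (AlgebraicClosure F) ≃+* RatFunc (AlgebraicClosure F) :=
    RingEquiv.ofRingHom (ratMap (fr : _ →+* _)) (ratMap (fr.symm : _ →+* _))
      (RingHom.ext fun r => by
        rw [RingHom.comp_apply, hratcomp, RingEquiv.comp_symm, hratid, RingHom.id_apply])
      (RingHom.ext fun r => by
        rw [RingHom.comp_apply, hratcomp, RingEquiv.symm_comp, hratid, RingHom.id_apply])
  have hτ : ∀ r, τ r = ratMap (fr : _ →+* _) r := fun r => rfl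
  have hτh : ∀ r, τ (ratMap h r) = ratMap h r := by
    intro r
    have : (ratMap (fr : AlgebraicClosure F →+* AlgebraicClosure F)).comp (ratMap h) = ratMap h := by
      refine ratFunc_ringHom_ext (fun x => ?_) ?_
      · simp only [RatFunc.algebraMap_eq_C, RingHom.comp_apply, ratMap_C, hfrh]
      · simp only [RingHom.comp_apply, ratMap_X]
    exact congrArg (fun g => g r) this
  have hτf : f.map (τ : _ →+* _) = f := by
    rw [← hf, Polynomial.map_map]
    congr 1
    exact RingHom.ext hτh
  obtain ⟨σ₁, hσ₁⟩ := exists_semilinear_lift (E := E) f τ hτf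
  have : IsGalois (RatFunc (AlgebraicClosure F)) E := IsGalois.of_separable_splitting_field hsep
  have : FiniteDimensional (RatFunc (AlgebraicClosure F)) E :=
    IsSplittingField.finiteDimensional E f
  let alg : Algebra (RatFunc F) E :=
    ((algebraMap (RatFunc (AlgebraicClosure F)) E).comp (ratMap h)).toAlgebra
  have halg : ∀ r : RatFunc F, algebraMap (RatFunc F) E r =
      algebraMap (RatFunc (AlgebraicClosure F)) E (ratMap h r) := fun r => rfl
  have hmap : f₀.map (algebraMap (RatFunc F) E) =
      f.map (algebraMap (RatFunc (AlgebraicClosure F)) E) := by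
    rw [← hf, Polynomial.map_map]
    rfl
  have hconst : ∀ x, algebraMap (AlgebraicClosure F) E x =
      algebraMap (RatFunc (AlgebraicClosure F)) E (RatFunc.C x) := fun x => by
    rw [IsScalarTower.algebraMap_apply _ (RatFunc (AlgebraicClosure F)) E, RatFunc.algebraMap_eq_C]
  have hf0 : f₀ ≠ 0 := by
    rintro rfl
    exact hsep.ne_zero (by rw [← hf, Polynomial.map_zero])
  have hroots : f₀.rootSet E = f.rootSet E := by
    ext y
    rw [mem_rootSet_of_ne hf0, mem_rootSet_of_ne hsep.ne_zero, ← eval_map_algebraMap, hmap,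
      eval_map_algebraMap]
  let σ : Gal(E/RatFunc F) := AlgEquiv.ofRingEquiv (f := σ₁) fun r => by
    rw [halg, hσ₁, hτh]
  have hσ : ∀ y, σ y = σ₁ y := fun y => rfl
  have hsplit : (f₀.map (algebraMap (RatFunc F) E)).Splits := by
    rw [hmap]
    exact IsSplittingField.splits E f
  obtain ⟨p, _⟩ := CharP.exists F
  have : CharP (RatFunc F) p := charP_of_injective_algebraMap (algebraMap F (RatFunc F)).injective p
  obtain ⟨c, hc, ⟨s, hs, hsr⟩, hcard⟩ := exists_automorphism_fixing_roots (p := p)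
    (q := Fintype.card F) (f := f₀) ((CharP.cast_eq_zero_iff F p _).1 (FiniteField.cast_card_eq_zero F))
    Fintype.one_lt_card (algebraMap (AlgebraicClosure F) E) fr hfr hsplit hf0 σ
    (fun x => by rw [hσ, hconst, hσ₁, hτ, ratMap_C, ← hconst]; rfl) (fun y hy hyσ => by
      have h1 : y ∈ Set.range (algebraMap (RatFunc (AlgebraicClosure F)) E) := by
        rw [IsGalois.mem_range_algebraMap_iff_fixed]
        intro g
        exact hy (AlgEquiv.ofRingEquiv (f := (g : E ≃+* E)) fun r => by
          rw [halg]; exact g.commutes _) fun x => by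
          rw [hconst]; exact g.commutes _
      obtain ⟨r, rfl⟩ := h1
      rw [hσ, hσ₁] at hyσ
      obtain ⟨s, rfl⟩ := exists_ratMap_eq h (fr : _ →+* _) 
        (fun x hx => mem_range_algebraMap_of_pow_card_eq hx) ((algebraMap _ E).injective hyσ)
      exact ⟨s, rfl⟩) E₀
  refine ⟨c, hc, ⟨s, hs, ?_, fun y hy => hsr y (hroots ▸ hy)⟩, hcard⟩
  have ht : tvar (AlgebraicClosure F) E = algebraMap (RatFunc F) E RatFunc.X := by
    rw [halg, ratMap_X]
    rfl
  rw [ht]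
  exact s.commutes _

end StepanovBound

namespace RatIterate

lemma iterPair_map {K M : Type*} [Field K] [Field M] (h : K →+* M) (p q : K[X]) (n : ℕ) :
    iterPair (p.map h) (q.map h) n = ((iterPair p q n).1.map h, (iterPair p q n).2.map h) := by
  induction n with
  | zero => simp [iterPair]
  | succ n ih =>
    rw [iterPair, ih, iterPair]
    simp only [pairComp, natDegree_map, coeff_map, Polynomial.map_sum, Polynomial.map_mul,
      Polynomial.map_pow, map_C]

lemma PhiPoly_map {K M : Type*} [Field K] [Field M] (h : K →+* M) (p q : K[X]) (n : ℕ) :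
    (PhiPoly K p q n).map (StepanovBound.ratMap h) = PhiPoly M (p.map h) (q.map h) n := by
  have hC : (StepanovBound.ratMap h).comp (RatFunc.C : K →+* RatFunc K) =
      (RatFunc.C : M →+* RatFunc M).comp h := RingHom.ext fun x => StepanovBound.ratMap_C h x
  simp only [PhiPoly, iterPair_map, Polynomial.map_sub, Polynomial.map_mul, Polynomial.map_map,
    map_C, StepanovBound.ratMap_X, hC]

lemma FPPgeo_nonneg {F : Type*} [Field F] (p q : F[X]) (n : ℕ) : 0 ≤ FPPgeo F p q n :=
  div_nonneg (Nat.cast_nonneg _) (Nat.cast_nonneg _)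

lemma FPPgeo_eq {F : Type*} [Field F] (p q : F[X]) (n : ℕ)
    {f : (RatFunc (AlgebraicClosure F))[X]}
    (hf : PhiPoly (AlgebraicClosure F) (p.map (algebraMap F (AlgebraicClosure F)))
      (q.map (algebraMap F (AlgebraicClosure F))) n = f) :
    FPPgeo F p q n = (Nat.card {g : f.Gal // ∃ y ∈ f.rootSet f.SplittingField, g y = y} : ℝ) /
      (Nat.card f.Gal : ℝ) := by
  subst hf
  rfl

/-- For a suitable `c`, the number of periodic points over `𝔽_{q^{ck}}` is bounded by the fixed
point proportion at level `n`, up to an error of square root size. -/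
lemma exists_perCount_le {F : Type*} [Field F] [Fintype F] {p q : F[X]}
    (hco : IsCoprime p q) (hd : 0 < max p.natDegree q.natDegree) (ℓ : ℕ)
    [Fact ℓ.Prime] [CharP F ℓ] (hdℓ : max p.natDegree q.natDegree < ℓ) (n : ℕ) :
    ∃ c : ℕ, 0 < c ∧
      Fintype.card F ^ c ≤ {x : (PhiPoly F p q n).SplittingField |
        x ^ Fintype.card F ^ c = x}.ncard ∧
      ∃ C₁ A₀ B : ℕ, ∀ a b k : ℕ, 0 < k → A₀ < ℓ ^ a → ℓ ^ b ≤ ℓ ^ a →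
        ℓ ^ (a + b) = Fintype.card F ^ (c * k) →
        (perCount F p q (c * k) : ℝ) ≤
          FPPgeo F p q n * ((Fintype.card F : ℝ) ^ (c * k) + C₁ * (ℓ : ℝ) ^ a) + B := by
  set h := algebraMap F (AlgebraicClosure F) with hh
  have hch : CharP (AlgebraicClosure F) ℓ := charP_of_injective_algebraMap h.injective ℓ
  have hexp : ExpChar (AlgebraicClosure F) ℓ := ExpChar.prime Fact.out
  set d := max p.natDegree q.natDegree with hdd
  have hdm : max (p.map h).natDegree (q.map h).natDegree = d := by
    rw [natDegree_map, natDegree_map]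
  have hcom : IsCoprime (p.map h) (q.map h) := hco.map (Polynomial.mapRingHom h)
  have hdm0 : 0 < max (p.map h).natDegree (q.map h).natDegree := hdm.symm ▸ hd
  obtain ⟨u, v, huv⟩ : ∃ u v, iterPair (p.map h) (q.map h) n = (u, v) := ⟨_, _, rfl⟩
  have hPhi : PhiPoly (AlgebraicClosure F) (p.map h) (q.map h) n = StepanovBound.pencil u v := by
    rw [PhiPoly, huv]
    rfl
  have hne : ∀ x, u.eval x ≠ 0 ∨ v.eval x ≠ 0 := by
    have := eval_iterPair_ne_zero hcom hdm0 n
    rwa [huv] at this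
  have hdeg := natDegree_iterPair_le (p.map h) (q.map h) n
  rw [huv, hdm] at hdeg
  have hcoeff := coeff_iterPair_ne_zero hcom hdm0 n
  rw [huv, hdm] at hcoeff
  have hd0 : ((d ^ n : ℕ) : AlgebraicClosure F) ≠ 0 := by
    rw [Nat.cast_pow]
    refine pow_ne_zero _ fun h0 => ?_
    exact Nat.not_dvd_of_pos_of_lt hd hdℓ ((CharP.cast_eq_zero_iff _ ℓ d).1 h0)
  have hbad := finite_not_isGoodAt hne hdeg.1 hdeg.2 hcoeff hd0
  obtain ⟨t₁, ht₁⟩ := hbad.infinite_compl.nonempty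
  obtain ⟨-, -, -, -, hsep⟩ := StepanovBound.exists_roots_pencil hdeg.1 hdeg.2 (not_not.1 ht₁)
  have hmap : (PhiPoly F p q n).map (StepanovBound.ratMap h) = StepanovBound.pencil u v := by
    rw [PhiPoly_map, hPhi]
  obtain ⟨c, hc, ⟨σ, hσ, hσt, hσr⟩, hcard⟩ :=
    StepanovBound.exists_power_frobenius_fixing_roots hmap hsep
      (StepanovBound.pencil u v).SplittingField (PhiPoly F p q n).SplittingField
  refine ⟨c, hc, hcard, ?_⟩
  have : IsGalois (RatFunc (AlgebraicClosure F)) (StepanovBound.pencil u v).SplittingField :=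
    IsGalois.of_separable_splitting_field hsep
  obtain ⟨C₁, A₀, hmain⟩ := StepanovBound.exists_card_mul_card_le
    (StepanovBound.pencil u v).SplittingField hdeg.1 hdeg.2 ℓ
  refine ⟨C₁, A₀, {t₀ | ¬ IsGoodAt u v (d ^ n) t₀}.ncard + 2, fun a b k hk ha hb hab => ?_⟩
  have hper := perCount_le hco hd n (Nat.mul_ne_zero hc.ne' hk.ne') huv (d ^ n) hbad
  set S : Set (AlgebraicClosure F) := {t₀ | IsGoodAt u v (d ^ n) t₀ ∧
    t₀ ^ Fintype.card F ^ (c * k) = t₀ ∧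
      ∃ x, x ^ Fintype.card F ^ (c * k) = x ∧ (u - C t₀ * v).eval x = 0} with hSdef
  have hS : S.Finite := by
    have hQ : 1 < Fintype.card F ^ (c * k) :=
      Nat.one_lt_pow (Nat.mul_ne_zero hc.ne' hk.ne') Fintype.one_lt_card
    refine ((X ^ Fintype.card F ^ (c * k) - X : (AlgebraicClosure F)[X]).rootSet_finite
      (AlgebraicClosure F)).subset fun x hx => ?_
    rw [mem_rootSet_of_ne (FiniteField.X_pow_card_sub_X_ne_zero (AlgebraicClosure F) hQ)]
    simpa [sub_eq_zero] using hx.2.1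
  have hσpow : ∀ x, (σ ^ k) (algebraMap (AlgebraicClosure F) _ x) =
      algebraMap (AlgebraicClosure F) _ (x ^ Fintype.card F ^ (c * k)) := by
    clear hab hper hSdef hS hk
    clear S
    induction k with
    | zero => intro x; simp
    | succ k ih =>
      intro x
      rw [pow_succ', RingAut.mul_apply, ih, hσ, ← pow_mul, ← pow_add, mul_add, mul_one]
  have hσfix : ∀ y, σ y = y → (σ ^ k) y = y := fun y hy =>
    Subgroup.pow_mem (MulAction.stabilizer (RingAut _) y) (x := σ) hy k
  have hbound := hmain a b ha hb (σ ^ k) (fun x => by rw [hab, hσpow]) (hσfix _ hσt)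
    (fun y hy => hσfix y (hσr y hy)) hS.toFinset fun t₀ ht₀ => by
      rw [hab]
      exact hS.mem_toFinset.1 ht₀
  rw [← Set.ncard_eq_toFinset_card S hS, hab] at hbound
  have hG : 0 < Nat.card (StepanovBound.pencil u v).Gal := Nat.card_pos
  have hFPP : FPPgeo F p q n = (Nat.card {g : (StepanovBound.pencil u v).Gal //
      ∃ y ∈ (StepanovBound.pencil u v).rootSet (StepanovBound.pencil u v).SplittingField,
        g y = y} : ℝ) / (Nat.card (StepanovBound.pencil u v).Gal : ℝ) := by
    exact FPPgeo_eq p q n hPhi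
  have hS' : (S.ncard : ℝ) ≤
      FPPgeo F p q n * ((Fintype.card F : ℝ) ^ (c * k) + C₁ * (ℓ : ℝ) ^ a) := by
    rw [hFPP, div_mul_eq_mul_div, le_div_iff₀ (by exact_mod_cast hG)]
    exact_mod_cast hbound
  refine (Nat.cast_le.2 hper).trans ?_
  push_cast
  linarith

end RatIterate

lemma ENat.eventually_natCast_le_limsup (m : ℕ → ℕ) :
    ∀ᶠ n in Filter.atTop, (m n : ℕ∞) ≤ Filter.limsup (fun n : ℕ => (m n : ℕ∞)) Filter.atTop := by
  induction hs : Filter.limsup (fun n : ℕ => (m n : ℕ∞)) Filter.atTop using ENat.recTopCoe with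
  | top => exact Filter.Eventually.of_forall fun n => le_top
  | coe s =>
    have h : Filter.limsup (fun n : ℕ => (m n : ℕ∞)) Filter.atTop < ((s + 1 : ℕ) : ℕ∞) := by
      rw [hs]
      exact_mod_cast Nat.lt_succ_self s
    filter_upwards [Filter.eventually_lt_of_limsup_lt h] with n hn
    exact_mod_cast Nat.lt_succ_iff.1 (by exact_mod_cast hn)

theorem stmt_8 (F : Type*) [Field F] [Fintype F]
    (p q : Polynomial F) (hco : IsCoprime p q)
    (hd2 : 2 ≤ max p.natDegree q.natDegree)
    (hdp : max p.natDegree q.natDegree < ringChar F)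
    (m : ℕ → ℕ)
    (hm : ∀ n : ℕ, 1 ≤ n → Nat.card {x : (PhiPoly F p q n).SplittingField //
        algebraicOver ((algebraMap (RatFunc F) (PhiPoly F p q n).SplittingField).comp
          (RatFunc.C : F →+* RatFunc F)) x} = Fintype.card F ^ m n)
    (L : ℝ) (hL : Filter.Tendsto (fun n : ℕ => FPPgeo F p q n) Filter.atTop (nhds L)) :
    ∀ ε : ℝ, 0 < ε → ∃ M k₀ : ℕ, 0 < M ∧ 0 < k₀ ∧
      (M : ℕ∞) ≤ Filter.limsup (fun n : ℕ => (m n : ℕ∞)) Filter.atTop ∧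
      ∀ k : ℕ, k₀ < k →
        (perCount F p q (M * k) : ℝ) / ((Fintype.card F : ℝ) ^ (M * k) + 1) < L + ε := by
  intro ε hε
  obtain ⟨n, hnL, hnm, hn1⟩ := ((hL.eventually (gt_mem_nhds (show L < L + ε / 2 by linarith))).and
    ((ENat.eventually_natCast_le_limsup m).and (Filter.eventually_ge_atTop 1))).exists
  have hchar : CharP F (ringChar F) := ringChar.charP F
  obtain ⟨e, hprime, he⟩ := FiniteField.card F (ringChar F)
  have hfact : Fact (ringChar F).Prime := ⟨hprime⟩
  set ℓ := ringChar F with hℓ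
  obtain ⟨c, hc, hcard, C₁, A₀, B, hmain⟩ :=
    RatIterate.exists_perCount_le hco (by omega) ℓ hdp n
  have hcm : c ≤ m n := by
    rw [← Nat.pow_le_pow_iff_right (Fintype.one_lt_card (α := F)), ← hm n hn1]
    refine hcard.trans ?_
    have hpos : 0 < Fintype.card F := Fintype.card_pos
    have hfin : Finite {x : (PhiPoly F p q n).SplittingField //
        algebraicOver ((algebraMap (RatFunc F) (PhiPoly F p q n).SplittingField).comp
          (RatFunc.C : F →+* RatFunc F)) x} :=
      Nat.finite_of_card_ne_zero (by rw [hm n hn1]; positivity)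
    refine Set.ncard_le_ncard (t := {x | algebraicOver _ x}) (fun x hx => ?_) hfin
    refine ⟨X ^ Fintype.card F ^ c - X, FiniteField.X_pow_card_sub_X_ne_zero F
      (Nat.one_lt_pow hc.ne' Fintype.one_lt_card), ?_⟩
    have hx' : x ^ Fintype.card F ^ c = x := hx
    simp [hx']
  set Φ := FPPgeo F p q n with hΦ
  have hΦ0 : 0 ≤ Φ := RatIterate.FPPgeo_nonneg p q n
  obtain ⟨T, hT⟩ := exists_nat_gt ((Φ * C₁ + B) / (ε / 2))
  refine ⟨c, 2 * (T + A₀) + 2, hc, by omega, le_trans (by exact_mod_cast hcm) hnm, fun k hk => ?_⟩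
  have he0 : 0 < (e : ℕ) := e.pos
  set N := e * (c * k) with hN
  set b := N / 2 with hb
  set a := N - b with ha
  have hkN : k ≤ N := by
    rw [hN, ← mul_assoc]
    exact Nat.le_mul_of_pos_left k (Nat.mul_pos he0 hc)
  have hℓ1 : 1 < ℓ := hprime.one_lt
  have hTb : T < ℓ ^ b := lt_of_le_of_lt (by omega) (Nat.lt_pow_self hℓ1 (n := b))
  have hAa : A₀ < ℓ ^ a := lt_of_le_of_lt (by omega) (Nat.lt_pow_self hℓ1 (n := a))
  have hba : ℓ ^ b ≤ ℓ ^ a := Nat.pow_le_pow_right (by omega) (by omega)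
  have hQ : ℓ ^ (a + b) = Fintype.card F ^ (c * k) := by
    rw [he, ← pow_mul, show a + b = N by omega]
  have hper := hmain a b k (by omega) hAa hba hQ
  have hQ' : (Fintype.card F : ℝ) ^ (c * k) = (ℓ : ℝ) ^ a * (ℓ : ℝ) ^ b := by
    rw [← pow_add]
    exact_mod_cast hQ.symm
  rw [hQ'] at hper ⊢
  have hA1 : (1 : ℝ) ≤ (ℓ : ℝ) ^ a := one_le_pow₀ (by exact_mod_cast hℓ1.le)
  have hTb' : (T : ℝ) < (ℓ : ℝ) ^ b := by exact_mod_cast hTb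
  set A : ℝ := (ℓ : ℝ) ^ a with hA
  set β : ℝ := (ℓ : ℝ) ^ b with hβ
  have hβ0 : 0 < β := lt_of_le_of_lt (Nat.cast_nonneg T) hTb'
  have h1 : Φ * C₁ + B < ε / 2 * β := by
    rw [div_lt_iff₀ (by positivity)] at hT
    nlinarith
  have h2 : (Φ * C₁ + B) * A < ε / 2 * β * A := mul_lt_mul_of_pos_right h1 (by linarith)
  have h3 : (B : ℝ) ≤ B * A := le_mul_of_one_le_right (Nat.cast_nonneg B) hA1
  have h4 : 0 < A * β := mul_pos (by linarith) hβ0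
  rw [div_lt_iff₀ (by linarith)]
  have h5 : (Φ + ε / 2) * (A * β) ≤ (L + ε) * (A * β + 1) := by
    have : Φ + ε / 2 ≤ L + ε := by linarith
    nlinarith
  nlinarith
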